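/- arXiv:1611.02455 — 2 statements merged into one kernel-verified Lean document; each statement's English description precedes it below -/
import Mathlib

section
/- Let t ≥ 2 and d_1, …, d_t ≥ 1 be integers, D = d_1 + ⋯ + d_t, and for each i let S_i ⊂ ℝ^{d_i} be a canonical Fano simplex (a d_i-dimensional simplex with vertices in ℤ^{d_i} whose interior contains exactly one lattice point, namely the origin). Let φ : ℝ^{d_1} × ⋯ × ℝ^{d_t} → ℝ^d be a linear map with φ(ℤ^D) = ℤ^d, and let P = φ(S_1 ⊕ ⋯ ⊕ S_t) ⊂ ℝ^d, where S_1 ⊕ ⋯ ⊕ S_t = conv(ι_1(S_1) ∪ ⋯ ∪ ι_t(S_t)) and ι_i is the inclusion of the i-th factor. Then 0 lies in the interior of P and vol(P*) ≤ (D! / d!) · vol(S_1*) ⋯ vol(S_t*). -/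
open MeasureTheory Set
open scoped ENNReal

/-- The Sylvester sequence, 0-indexed: `sylvester 0 = 2 = s₁`,
`sylvester (n+1) = (sylvester n)^2 - sylvester n + 1`, so that `sₙ = sylvester (n-1)`. -/
def sylvester : ℕ → ℕ
  | 0 => 2
  | n + 1 => (sylvester n) ^ 2 - sylvester n + 1

/-- A point of `ℝ^d` is a lattice point if all its coordinates are integers. -/
def IsLatticePt {d : ℕ} (x : Fin d → ℝ) : Prop := ∀ i, ∃ z : ℤ, x i = (z : ℝ)

/-- A lattice polytope: the convex hull of finitely many lattice points. -/
def IsLatticePolytope {d : ℕ} (P : Set (Fin d → ℝ)) : Prop :=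
  ∃ V : Finset (Fin d → ℝ), (∀ v ∈ V, IsLatticePt v) ∧ P = convexHull ℝ (V : Set (Fin d → ℝ))

/-- A canonical Fano polytope in `ℝ^d`: a lattice polytope (automatically of full
dimension `d`) whose interior contains exactly one lattice point, namely the origin. -/
def IsCanonicalFano {d : ℕ} (P : Set (Fin d → ℝ)) : Prop :=
  IsLatticePolytope P ∧ {x ∈ interior P | IsLatticePt x} = {0}

/-- The dual (polar) of a set `P ⊆ ℝ^d`: all `y` with `⟨y, x⟩ ≥ -1` for every `x ∈ P`. -/
def polarDual {d : ℕ} (P : Set (Fin d → ℝ)) : Set (Fin d → ℝ) :=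
  {y | ∀ x ∈ P, -1 ≤ ∑ i, y i * x i}

/-- A simplex of dimension `k` in `ℝ^d`: the convex hull of `k + 1` affinely
independent points. -/
def IsSimplexOfDim {d : ℕ} (k : ℕ) (S : Set (Fin d → ℝ)) : Prop :=
  ∃ f : Fin (k + 1) → (Fin d → ℝ), AffineIndependent ℝ f ∧ S = convexHull ℝ (Set.range f)

/-- A canonical Fano polytope of dimension `k` with respect to the lattice
`lin(S) ∩ ℤ^d`: a lattice polytope of dimension `k` whose relative interior contains
exactly one lattice point, namely the origin. -/
def IsCanonicalFanoOfDim {d : ℕ} (k : ℕ) (S : Set (Fin d → ℝ)) : Prop :=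
  IsLatticePolytope S ∧ Module.finrank ℝ ↥(vectorSpan ℝ S) = k ∧
    {x ∈ intrinsicInterior ℝ S | IsLatticePt x} = {0}

/-- Minimality for canonical Fano polytopes of dimension `k` (w.r.t. `lin(S) ∩ ℤ^d`):
removing any vertex destroys the property. -/
def IsMinimalCanonicalFanoOfDim {d : ℕ} (k : ℕ) (S : Set (Fin d → ℝ)) : Prop :=
  IsCanonicalFanoOfDim k S ∧ ∀ v ∈ Set.extremePoints ℝ S,
    ¬ IsCanonicalFanoOfDim k (convexHull ℝ ({x ∈ S | IsLatticePt x} \ {v}))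

/-- A minimal (full-dimensional) canonical Fano polytope in `ℝ^d`: removing any vertex
destroys the property of being a `d`-dimensional canonical Fano polytope. -/
def IsMinimalCanonicalFano {d : ℕ} (P : Set (Fin d → ℝ)) : Prop :=
  IsCanonicalFano P ∧ ∀ v ∈ Set.extremePoints ℝ P,
    ¬ IsCanonicalFano (convexHull ℝ ({x ∈ P | IsLatticePt x} \ {v}))

theorem volume_add_le_of_isCompact {K L C : Set ℝ} (hK : IsCompact K) (hL : IsCompact L)
    (hK0 : K.Nonempty) (hL0 : L.Nonempty)
    (h : ∀ x ∈ K, ∀ y ∈ L, x + y ∈ C) : volume K + volume L ≤ volume C := by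
  obtain ⟨m, hm, hmax⟩ := hK.exists_isGreatest hK0
  obtain ⟨l, hl, hmin⟩ := hL.exists_isLeast hL0
  have h1 : volume ((fun x => x + l) '' K ∪ (fun y => m + y) '' L) ≤ volume C := by
    apply measure_mono
    rintro _ (⟨x, hx, rfl⟩ | ⟨y, hy, rfl⟩)
    · exact h _ hx _ hl
    · exact h _ hm _ hy
  have hd : AEDisjoint volume ((fun x => x + l) '' K) ((fun y => m + y) '' L) := by
    refine measure_mono_null (t := {m + l}) ?_ (by simp)
    rintro _ ⟨⟨x, hx, rfl⟩, ⟨y, hy, e⟩⟩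
    have := hmax hx
    have := hmin hy
    simp only at e
    simp only [mem_singleton_iff]
    linarith
  have hm' : IsCompact ((fun y => m + y) '' L) := hL.image (by fun_prop)
  rw [measure_union₀ hm'.measurableSet.nullMeasurableSet hd] at h1
  simpa [image_add_right, image_add_left] using h1

theorem volume_add_le {A B C : Set ℝ} (hA : MeasurableSet A) (hB : MeasurableSet B)
    (hA0 : A.Nonempty) (hB0 : B.Nonempty)
    (h : ∀ x ∈ A, ∀ y ∈ B, x + y ∈ C) : volume A + volume B ≤ volume C := by
  obtain ⟨a, ha⟩ := hA0
  obtain ⟨b, hb⟩ := hB0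
  rw [hA.measure_eq_iSup_isCompact, hB.measure_eq_iSup_isCompact]
  have := ENNReal.biSup_add_biSup_le' (p := fun K => K ⊆ A ∧ IsCompact K)
    (q := fun K => K ⊆ B ∧ IsCompact K) (f := fun K => volume K) (g := fun K => volume K)
    (a := volume C) ⟨∅, by simp⟩ ⟨∅, by simp⟩ (by
      rintro K ⟨hKA, hK⟩ L ⟨hLB, hL⟩
      refine (add_le_add (measure_mono (subset_insert a K))
        (measure_mono (subset_insert b L))).trans ?_
      refine volume_add_le_of_isCompact (hK.insert a) (hL.insert b) (by simp) (by simp) ?_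
      intro x hx y hy
      exact h x (insert_subset ha hKA hx) y (insert_subset hb hLB hy))
  simpa [iSup_and] using this

theorem lintegral_eq_lintegral_meas_lt_of_le_one {f : ℝ → ℝ≥0∞} (hf : Measurable f)
    (h1 : ∀ x, f x ≤ 1) :
    ∫⁻ x, f x = ∫⁻ t in Ioo (0 : ℝ) 1, volume {x | ENNReal.ofReal t < f x} := by
  have hfin : ∀ x, f x ≠ ∞ := fun x => ((h1 x).trans_lt ENNReal.one_lt_top).ne
  have e := lintegral_eq_lintegral_meas_lt (f := fun x => (f x).toReal) volume
    (Filter.Eventually.of_forall fun x => by simp) hf.ennreal_toReal.aemeasurable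
  simp only [ENNReal.ofReal_toReal (hfin _)] at e
  rw [e, ← lintegral_indicator measurableSet_Ioi, ← lintegral_indicator measurableSet_Ioo]
  refine lintegral_congr fun t => ?_
  by_cases ht : t ∈ Ioo (0 : ℝ) 1
  · rw [indicator_of_mem ht, indicator_of_mem (Ioo_subset_Ioi_self ht)]
    congr 1
    ext x
    simp [ENNReal.ofReal_lt_iff_lt_toReal ht.1.le (hfin x)]
  · rw [indicator_of_notMem ht]
    refine indicator_apply_eq_zero.2 fun ht0 => ?_
    have : 1 ≤ t := by
      by_contra! hh
      exact ht ⟨ht0, hh⟩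
    convert measure_empty (μ := (volume : Measure ℝ))
    ext x
    simp only [mem_ofPred_eq, mem_empty_iff_false, iff_false, not_lt]
    exact (ENNReal.toReal_mono ENNReal.one_ne_top (h1 x)).trans (by simpa using this)

theorem ENNReal.geom_mean_le_arith_mean₂ {a b : ℝ} (ha : 0 < a) (hb : 0 < b) (hab : a + b = 1)
    (x y : ℝ≥0∞) : x ^ a * y ^ b ≤ ENNReal.ofReal a * x + ENNReal.ofReal b * y := by
  rcases eq_or_ne x ∞ with rfl | hx
  · simp [ENNReal.mul_top, ha]
  rcases eq_or_ne y ∞ with rfl | hy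
  · simp [ENNReal.mul_top, hb]
  lift x to NNReal using hx
  lift y to NNReal using hy
  have := NNReal.geom_mean_le_arith_mean2_weighted ⟨a, ha.le⟩ ⟨b, hb.le⟩ x y (by ext; exact hab)
  rw [← ENNReal.coe_rpow_of_nonneg _ ha.le, ← ENNReal.coe_rpow_of_nonneg _ hb.le]
  rw [ENNReal.ofReal_eq_coe_nnreal ha.le, ENNReal.ofReal_eq_coe_nnreal hb.le]
  exact_mod_cast this

theorem lintegral_add_le_of_iSup_eq_one {f g h : ℝ → ℝ≥0∞} (hf : Measurable f) (hg : Measurable g)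
    (hh : Measurable h) (hf1 : ⨆ x, f x = 1) (hg1 : ⨆ x, g x = 1) {a b : ℝ} (ha : 0 < a)
    (hb : 0 < b) (hab : a + b = 1) (H : ∀ x y, f x ^ a * g y ^ b ≤ h (a * x + b * y)) :
    ENNReal.ofReal a * (∫⁻ x, f x) + ENNReal.ofReal b * (∫⁻ x, g x) ≤ ∫⁻ x, h x := by
  have hfl : ∀ x, f x ≤ 1 := fun x => hf1 ▸ le_iSup f x
  have hgl : ∀ x, g x ≤ 1 := fun x => hg1 ▸ le_iSup g x
  have hmin : Measurable fun x => min (h x) 1 := hh.min measurable_const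
  refine le_trans ?_ (lintegral_mono fun x => min_le_left (h x) 1)
  rw [lintegral_eq_lintegral_meas_lt_of_le_one hf hfl,
    lintegral_eq_lintegral_meas_lt_of_le_one hg hgl,
    lintegral_eq_lintegral_meas_lt_of_le_one hmin fun x => min_le_right _ _,
    ← lintegral_const_mul' _ _ ENNReal.ofReal_ne_top,
    ← lintegral_const_mul' _ _ ENNReal.ofReal_ne_top]
  rw [← lintegral_add_left']
  · refine setLIntegral_mono' measurableSet_Ioo fun t ht => ?_
    have key : ∀ {c : ℝ} (hc : 0 < c) (s : Set ℝ),
        ENNReal.ofReal c * volume s = volume ((fun x => c⁻¹ * x) ⁻¹' s) := by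
      intro c hc s
      rw [Real.volume_preimage_mul_left (by positivity), inv_inv, abs_of_pos hc]
    rw [key ha, key hb]
    have ht1 : ENNReal.ofReal t < 1 := by simpa using ht.2
    have hne : ∀ {f : ℝ → ℝ≥0∞} (_ : ⨆ x, f x = 1) {c : ℝ} (_ : 0 < c),
        ((fun x => c⁻¹ * x) ⁻¹' {x | ENNReal.ofReal t < f x}).Nonempty := by
      intro f hf c hc
      obtain ⟨x, hx⟩ := lt_iSup_iff.1 (hf ▸ ht1)
      exact ⟨c * x, by simpa [hc.ne'] using hx⟩
    refine volume_add_le ?_ ?_ (hne hf1 ha) (hne hg1 hb) ?_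
    · exact (measurableSet_lt measurable_const hf).preimage (by fun_prop)
    · exact (measurableSet_lt measurable_const hg).preimage (by fun_prop)
    · intro x hx y hy
      simp only [mem_preimage, mem_ofPred_eq] at hx hy
      simp only [mem_ofPred_eq, lt_min_iff, ht1, and_true]
      have h2 := H (a⁻¹ * x) (b⁻¹ * y)
      rw [mul_inv_cancel_left₀ ha.ne', mul_inv_cancel_left₀ hb.ne'] at h2
      refine lt_of_lt_of_le ?_ h2
      have e : ENNReal.ofReal t = ENNReal.ofReal t ^ a * ENNReal.ofReal t ^ b := by
        rw [← ENNReal.rpow_add_of_nonneg _ _ ha.le hb.le, hab, ENNReal.rpow_one]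
      rw [e]
      exact ENNReal.mul_lt_mul (ENNReal.rpow_lt_rpow hx ha) (ENNReal.rpow_lt_rpow hy hb)
  · refine (Antitone.measurable ?_).aemeasurable
    intro s t hst
    refine mul_le_mul_right (measure_mono fun x hx => ?_) _
    exact lt_of_le_of_lt (ENNReal.ofReal_le_ofReal hst) hx

theorem prekopa_leindler_real_of_bounded {f g h : ℝ → ℝ≥0∞} (hf : Measurable f) (hg : Measurable g)
    (hh : Measurable h) (hf1 : ⨆ x, f x ≠ ∞) (hg1 : ⨆ x, g x ≠ ∞) {a b : ℝ} (ha : 0 < a)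
    (hb : 0 < b) (hab : a + b = 1) (H : ∀ x y, f x ^ a * g y ^ b ≤ h (a * x + b * y)) :
    (∫⁻ x, f x) ^ a * (∫⁻ x, g x) ^ b ≤ ∫⁻ x, h x := by
  set F := ⨆ x, f x with hF
  set G := ⨆ x, g x with hG
  rcases eq_or_ne F 0 with h0 | h0
  · have : ∀ x, f x = 0 := fun x => le_antisymm (h0 ▸ le_iSup f x) bot_le
    simp [this, ha]
  rcases eq_or_ne G 0 with h0' | h0'
  · have : ∀ x, g x = 0 := fun x => le_antisymm (h0' ▸ le_iSup g x) bot_le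
    simp [this, hb]
  have hc0 : F ^ a * G ^ b ≠ 0 := by simp [h0, h0', hf1, hg1]
  have hct : F ^ a * G ^ b ≠ ∞ :=
    ENNReal.mul_ne_top (ENNReal.rpow_ne_top_of_nonneg ha.le hf1)
      (ENNReal.rpow_ne_top_of_nonneg hb.le hg1)
  have := lintegral_add_le_of_iSup_eq_one (f := fun x => F⁻¹ * f x) (g := fun x => G⁻¹ * g x)
    (h := fun x => (F ^ a * G ^ b)⁻¹ * h x) (hf.const_mul _) (hg.const_mul _) (hh.const_mul _)
    (by rw [← ENNReal.mul_iSup, ENNReal.inv_mul_cancel h0 hf1])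
    (by rw [← ENNReal.mul_iSup, ENNReal.inv_mul_cancel h0' hg1]) ha hb hab (by
      intro x y
      rw [ENNReal.mul_rpow_of_nonneg _ _ ha.le, ENNReal.mul_rpow_of_nonneg _ _ hb.le,
        mul_mul_mul_comm, ENNReal.mul_inv (by simp [h0, hf1]) (by simp [h0', hg1]),
        ENNReal.inv_rpow, ENNReal.inv_rpow]
      gcongr
      exact H x y)
  have h3 := (ENNReal.geom_mean_le_arith_mean₂ ha hb hab _ _).trans this
  rw [lintegral_const_mul _ hf, lintegral_const_mul _ hg, lintegral_const_mul _ hh,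
    ENNReal.mul_rpow_of_nonneg _ _ ha.le, ENNReal.mul_rpow_of_nonneg _ _ hb.le,
    mul_mul_mul_comm, ENNReal.inv_rpow, ENNReal.inv_rpow,
    ← ENNReal.mul_inv (by simp [h0, hf1]) (by simp [h0', hg1])] at h3
  exact (ENNReal.mul_le_mul_iff_right (ENNReal.inv_ne_zero.2 hct) (ENNReal.inv_ne_top.2 hc0)).1 h3

/-- The Prékopa–Leindler inequality on the line. -/
theorem prekopa_leindler_real {f g h : ℝ → ℝ≥0∞} (hf : Measurable f) (hg : Measurable g)
    (hh : Measurable h) {a b : ℝ} (ha : 0 < a) (hb : 0 < b) (hab : a + b = 1)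
    (H : ∀ x y, f x ^ a * g y ^ b ≤ h (a * x + b * y)) :
    (∫⁻ x, f x) ^ a * (∫⁻ x, g x) ^ b ≤ ∫⁻ x, h x := by
  have trunc : ∀ {f : ℝ → ℝ≥0∞}, Measurable f → ∀ {a : ℝ}, 0 < a →
      (∫⁻ x, f x) ^ a = ⨆ n : ℕ, (∫⁻ x, min (f x) n) ^ a := by
    intro f hf a ha
    have e : ∀ x, f x = ⨆ n : ℕ, min (f x) n := fun x => by
      rw [← inf_iSup_eq, ENNReal.iSup_natCast, inf_top_eq]
    conv_lhs => enter [1, 2, x]; rw [e x]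
    rw [lintegral_iSup (fun n => hf.min measurable_const)
      (fun m n hmn x => min_le_min_left _ (by exact_mod_cast hmn))]
    exact (ENNReal.orderIsoRpow a ha).map_iSup _
  rw [trunc hf ha, trunc hg hb]
  simp_rw [ENNReal.iSup_mul, ENNReal.mul_iSup]
  refine iSup_le fun m => iSup_le fun n => ?_
  refine prekopa_leindler_real_of_bounded (hf.min measurable_const) (hg.min measurable_const) hh
    ?_ ?_ ha hb hab fun x y => le_trans ?_ (H x y)
  · exact ((iSup_le fun x => min_le_right _ _).trans_lt (ENNReal.natCast_lt_top m)).ne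
  · exact ((iSup_le fun x => min_le_right _ _).trans_lt (ENNReal.natCast_lt_top n)).ne
  · gcongr <;> exact min_le_left _ _

def IsLogConcave {E : Type*} [AddCommGroup E] [Module ℝ E] (f : E → ℝ≥0∞) : Prop :=
  ∀ (x y : E) (a b : ℝ), 0 < a → 0 < b → a + b = 1 → f x ^ a * f y ^ b ≤ f (a • x + b • y)

namespace IsLogConcave

variable {E : Type*} [AddCommGroup E] [Module ℝ E]

theorem mul {f g : E → ℝ≥0∞} (hf : IsLogConcave f) (hg : IsLogConcave g) :
    IsLogConcave fun x => f x * g x := by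
  intro x y a b ha hb hab
  rw [ENNReal.mul_rpow_of_nonneg _ _ ha.le, ENNReal.mul_rpow_of_nonneg _ _ hb.le, mul_mul_mul_comm]
  exact mul_le_mul' (hf x y a b ha hb hab) (hg x y a b ha hb hab)

theorem prod {ι : Type*} (s : Finset ι) {f : ι → E → ℝ≥0∞} (hf : ∀ i ∈ s, IsLogConcave (f i)) :
    IsLogConcave fun x => ∏ i ∈ s, f i x := by
  classical
  induction s using Finset.induction_on with
  | empty => intro x y a b _ _ _; simp
  | insert i s hi ih =>
    simp_rw [Finset.prod_insert hi]
    exact (hf i (by simp)).mul (ih fun j hj => hf j (by simp [hj]))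

theorem comp_linearMap {F : Type*} [AddCommGroup F] [Module ℝ F] {f : F → ℝ≥0∞}
    (hf : IsLogConcave f) (l : E →ₗ[ℝ] F) : IsLogConcave fun x => f (l x) := by
  intro x y a b ha hb hab
  simpa using hf (l x) (l y) a b ha hb hab

theorem indicator_one {s : Set E} (hs : Convex ℝ s) : IsLogConcave (s.indicator 1) := by
  intro x y a b ha hb hab
  by_cases hx : x ∈ s
  · by_cases hy : y ∈ s
    · simp [hx, hy, hs hx hy ha.le hb.le hab]
    · simp [hy, hb]
  · simp [hx, ha]

theorem le_of_even {f : ℝ → ℝ≥0∞} (hf : IsLogConcave f) (he : ∀ x, f (-x) = f x) {x y : ℝ}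
    (h : |x| ≤ |y|) : f y ≤ f x := by
  rcases h.eq_or_lt with h | h
  · rcases abs_eq_abs.1 h with rfl | rfl
    · exact le_rfl
    · exact (he _).ge
  · have hy : 0 < |y| := (abs_nonneg x).trans_lt h
    have hy0 : y ≠ 0 := abs_pos.1 hy
    have hq : |x / y| < 1 := by rwa [abs_div, div_lt_one hy]
    rw [abs_lt] at hq
    have := hf y (-y) ((1 + x / y) / 2) ((1 - x / y) / 2) (by linarith) (by linarith) (by ring)
    rw [he, ← ENNReal.rpow_add_of_nonneg _ _ (by linarith) (by linarith)] at this
    convert this using 1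
    · rw [show (1 + x / y) / 2 + (1 - x / y) / 2 = 1 by ring, ENNReal.rpow_one]
    · congr 1
      simp only [smul_eq_mul]
      field_simp
      ring

open Finset in
theorem lmarginal {ι : Type*} [DecidableEq ι] {f : (ι → ℝ) → ℝ≥0∞}
    (hf : IsLogConcave f) (hm : Measurable f) (s : Finset ι) :
    IsLogConcave (∫⋯∫⁻_s, f ∂fun _ => volume) := by
  induction s using Finset.induction_on with
  | empty => simpa using hf
  | insert i s hi ih =>
    intro x y a b ha hb hab
    have hmm := hm.lmarginal (fun _ : ι => (volume : Measure ℝ)) (s := s)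
    simp_rw [lmarginal_insert f hm hi]
    refine prekopa_leindler_real (hmm.comp (measurable_update x)) (hmm.comp (measurable_update y))
      (hmm.comp (measurable_update _)) ha hb hab fun u v => ?_
    refine (ih (Function.update x i u) (Function.update y i v) a b ha hb hab).trans_eq ?_
    congr 1
    ext j
    by_cases hj : j = i
    · subst hj; simp
    · simp [hj]

end IsLogConcave

theorem lmarginal_neg {ι : Type*} [DecidableEq ι] {f : (ι → ℝ) → ℝ≥0∞}
    (he : ∀ x, f (-x) = f x) (s : Finset ι) (x : ι → ℝ) :
    (∫⋯∫⁻_s, f ∂fun _ => volume) (-x) = (∫⋯∫⁻_s, f ∂fun _ => volume) x := by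
  simp only [lmarginal]
  rw [← lintegral_neg_eq_self]
  refine lintegral_congr fun y => ?_
  rw [← he]
  congr 1
  ext j
  by_cases hj : j ∈ s <;> simp [Function.updateFinset, hj]

theorem lintegral_mul_le_of_antitone_abs {g w : ℝ → ℝ≥0∞} (hg : Measurable g) (hw : Measurable w)
    (h : ∀ x y : ℝ, |x| ≤ |y| → w y ≤ w x) (hg1 : ∀ x, g x ≤ 1) (hgi : ∫⁻ x, g x = 1) {r : ℝ}
    (hr : ENNReal.ofReal (2 * r) = 1) (hr0 : 0 ≤ r) :
    ∫⁻ x, g x * w x ≤ ∫⁻ x, (Ioo (-r) r).indicator 1 x * w x := by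
  have hI : MeasurableSet (Ioo (-r) r) := measurableSet_Ioo
  have e : ∀ x, (Ioo (-r) r).indicator 1 x * w x = (Ioo (-r) r).indicator w x := by
    intro x; by_cases hx : x ∈ Ioo (-r) r <;> simp [hx]
  simp_rw [e]
  rw [lintegral_indicator hI, ← lintegral_add_compl _ hI]
  have hfin : ∫⁻ x in Ioo (-r) r, g x ≠ ∞ :=
    ((setLIntegral_le_lintegral _ _).trans_lt (hgi ▸ ENNReal.one_lt_top)).ne
  have h1 : ∫⁻ x in (Ioo (-r) r)ᶜ, g x * w x ≤ (∫⁻ x in (Ioo (-r) r)ᶜ, g x) * w r := by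
    rw [← lintegral_mul_const _ hg]
    refine setLIntegral_mono' hI.compl fun x hx => ?_
    gcongr
    refine h _ _ ?_
    rw [abs_of_nonneg hr0]
    by_contra! hh
    exact hx (abs_lt.1 hh)
  have h2 : ∫⁻ x in (Ioo (-r) r)ᶜ, g x = ∫⁻ x in Ioo (-r) r, (1 - g x) := by
    rw [lintegral_sub hg hfin (Filter.Eventually.of_forall hg1)]
    refine ENNReal.eq_sub_of_add_eq hfin ?_
    rw [add_comm, lintegral_add_compl _ hI, hgi]
    rw [setLIntegral_one, Real.volume_Ioo, ← hr]
    congr 1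
    ring
  have h3 : (∫⁻ x in Ioo (-r) r, (1 - g x)) * w r ≤ ∫⁻ x in Ioo (-r) r, (1 - g x) * w x := by
    have hg' : Measurable fun x => 1 - g x := measurable_const.sub hg
    rw [← lintegral_mul_const _ hg']
    refine setLIntegral_mono' hI fun x hx => ?_
    gcongr
    refine h _ _ ?_
    rw [abs_of_nonneg hr0]
    exact (abs_lt.2 hx).le
  calc _ ≤ (∫⁻ x in Ioo (-r) r, g x * w x) + ∫⁻ x in Ioo (-r) r, (1 - g x) * w x := by
        exact add_le_add le_rfl (h1.trans (h2 ▸ h3))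
    _ = _ := by
        have hgw : Measurable fun x => g x * w x := hg.mul hw
        rw [← lintegral_add_left hgw]
        refine lintegral_congr fun x => ?_
        rw [← add_mul, add_tsub_cancel_of_le (hg1 x), one_mul]

theorem lintegral_indicator_mul_prod_le {ι : Type*} [Fintype ι] {g : ℝ → ℝ≥0∞} (hg : Measurable g)
    (hgc : IsLogConcave g) (hge : ∀ x, g (-x) = g x)
    (hg1 : ∀ x, g x ≤ 1) (hgi : ∫⁻ x, g x = 1) {A : Set (ι → ℝ)} (hA : Convex ℝ A)
    (hAm : MeasurableSet A) (hAs : ∀ x ∈ A, -x ∈ A) :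
    ∫⁻ p in A, ∏ i, g (p i) ≤ volume (A ∩ {p | ∀ i, |p i| < 1 / 2}) := by
  classical
  set χ : ℝ → ℝ≥0∞ := (Ioo (-(1 / 2)) (1 / 2)).indicator 1 with hχ
  have hχm : Measurable χ := measurable_one.indicator measurableSet_Ioo
  have hχc : IsLogConcave χ := IsLogConcave.indicator_one (convex_Ioo _ _)
  have hχe : ∀ x, χ (-x) = χ x := by
    intro x
    have : -x ∈ Ioo (-(1 / 2) : ℝ) (1 / 2) ↔ x ∈ Ioo (-(1 / 2) : ℝ) (1 / 2) := by
      rw [mem_Ioo, mem_Ioo, ← abs_lt, ← abs_lt, abs_neg]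
    by_cases hx : x ∈ Ioo (-(1 / 2) : ℝ) (1 / 2)
    · rw [hχ, indicator_of_mem hx, indicator_of_mem (this.2 hx)]; rfl
    · rw [hχ, indicator_of_notMem hx, indicator_of_notMem (mt this.1 hx)]
  let ψ : Finset ι → ι → ℝ → ℝ≥0∞ := fun s i => if i ∈ s then χ else g
  have hψm : ∀ s i, Measurable (ψ s i) := fun s i => by
    by_cases h : i ∈ s <;> simp [ψ, h, hχm, hg]
  have hψc : ∀ s i, IsLogConcave (ψ s i) := fun s i => by
    by_cases h : i ∈ s <;> simp [ψ, h, hχc, hgc]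
  have hψe : ∀ s i x, ψ s i (-x) = ψ s i x := fun s i x => by
    by_cases h : i ∈ s <;> simp [ψ, h, hχe, hge]
  have main : ∀ s : Finset ι, ∫⁻ p, A.indicator 1 p * ∏ i, g (p i) ≤
      ∫⁻ p, A.indicator 1 p * ∏ i, ψ s i (p i) := by
    intro s
    induction s using Finset.induction_on with
    | empty => simp [ψ]
    | insert i s hi ih =>
      refine ih.trans ?_
      set K : (ι → ℝ) → ℝ≥0∞ := fun p => A.indicator 1 p * ∏ j ∈ Finset.univ.erase i, ψ s j (p j)
        with hK
      have hKm : Measurable K := (measurable_one.indicator hAm).mul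
        (Finset.measurable_prod _ fun j _ => (hψm s j).comp (measurable_pi_apply j))
      have hKc : IsLogConcave K := (IsLogConcave.indicator_one hA).mul
        (IsLogConcave.prod _ fun j _ => (hψc s j).comp_linearMap (LinearMap.proj (R := ℝ) (φ := fun _ => ℝ) j))
      have hKe : ∀ x, K (-x) = K x := by
        intro x
        have : -x ∈ A ↔ x ∈ A := ⟨fun h => by simpa using hAs _ h, hAs x⟩
        simp only [hK, Pi.neg_apply, hψe]
        by_cases h : x ∈ A
        · rw [indicator_of_mem h, indicator_of_mem (this.2 h)]; rfl
        · rw [indicator_of_notMem h, indicator_of_notMem (mt this.1 h)]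
      set L := ∫⋯∫⁻_Finset.univ.erase i, K ∂fun _ => volume with hL
      have hLm : Measurable L := hKm.lmarginal _
      have key : ∀ g : ℝ → ℝ≥0∞, Measurable g →
          ∫⁻ p, g (p i) * K p = ∫⁻ u, g u * L (Function.update 0 i u) := by
        intro g hg
        have hm : Measurable fun p : ι → ℝ => g (p i) * K p :=
          (hg.comp (measurable_pi_apply i)).mul hKm
        rw [volume_pi, lintegral_eq_lmarginal_univ 0, ← Finset.insert_erase (Finset.mem_univ i),
          lmarginal_insert _ hm (Finset.notMem_erase i _)]
        refine lintegral_congr fun u => ?_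
        simp only [hL, lmarginal]
        have hKu : ∀ x, Measurable fun y => K (Function.updateFinset x (Finset.univ.erase i) y) :=
          fun x => hKm.comp measurable_updateFinset
        rw [← lintegral_const_mul _ (hKu _)]
        refine lintegral_congr fun y => ?_
        simp [Function.updateFinset]
      have e1 : ∀ p, A.indicator 1 p * ∏ j, ψ s j (p j) = g (p i) * K p := by
        intro p
        rw [← Finset.mul_prod_erase _ _ (Finset.mem_univ i), hK]
        simp only [ψ, hi, if_false]
        ring
      have e2 : ∀ p, A.indicator 1 p * ∏ j, ψ (insert i s) j (p j) = χ (p i) * K p := by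
        intro p
        rw [← Finset.mul_prod_erase _ _ (Finset.mem_univ i), hK]
        have : ∏ j ∈ Finset.univ.erase i, ψ (insert i s) j (p j) =
            ∏ j ∈ Finset.univ.erase i, ψ s j (p j) := by
          refine Finset.prod_congr rfl fun j hj => ?_
          simp [ψ, Finset.ne_of_mem_erase hj]
        rw [this]
        simp only [ψ, Finset.mem_insert_self, if_true]
        ring
      simp_rw [e1, e2]
      rw [key g hg, key χ hχm]
      refine lintegral_mul_le_of_antitone_abs hg (hLm.comp (measurable_update 0)) ?_ hg1 hgi
        (by norm_num) (by norm_num)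
      have hlc : IsLogConcave fun u : ℝ => L (Function.update 0 i u) :=
        (hKc.lmarginal hKm _).comp_linearMap (LinearMap.single ℝ (fun _ => ℝ) i)
      intro x y hxy
      refine hlc.le_of_even (fun u => ?_) hxy
      rw [hL, ← lmarginal_neg hKe]
      congr 1
      ext j
      by_cases hj : j = i
      · subst hj; simp
      · simp [hj]
  have := main Finset.univ
  rw [← lintegral_indicator hAm]
  convert this using 1
  · refine lintegral_congr fun p => ?_
    by_cases hp : p ∈ A <;> simp [hp]
  · have hB : MeasurableSet (A ∩ {p : ι → ℝ | ∀ i, |p i| < 1 / 2}) := by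
      refine hAm.inter ?_
      simp only [Set.ofPred_forall]
      exact MeasurableSet.iInter fun i => measurableSet_lt (by fun_prop) (by fun_prop)
    rw [← lintegral_indicator_one hB]
    refine lintegral_congr fun p => ?_
    by_cases hp : p ∈ A
    · by_cases hq : ∀ i, |p i| < 1 / 2
      · have : ∀ i, p i ∈ Ioo (-(1 / 2) : ℝ) (1 / 2) := fun i => abs_lt.1 (hq i)
        have hpq : p ∈ A ∩ {p | ∀ i, |p i| < 1 / 2} := ⟨hp, hq⟩
        rw [indicator_of_mem hpq, indicator_of_mem hp]
        simp only [ψ, Finset.mem_univ, if_true, hχ]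
        rw [Finset.prod_eq_one fun i _ => by rw [indicator_of_mem (this i)]; rfl]
        simp
      · rw [indicator_of_notMem fun h => hq h.2]
        push Not at hq
        obtain ⟨i, hi⟩ := hq
        rw [Finset.prod_eq_zero (Finset.mem_univ i), mul_zero]
        simp only [ψ, Finset.mem_univ, if_true, hχ]
        rw [indicator_of_notMem]
        exact fun h => hi.not_gt (abs_lt.2 h)
    · simp [hp]

theorem Matrix.exists_left_inverse_of_mulVec_eq_zero {m n K : Type*} [Fintype m] [Fintype n]
    [DecidableEq m] [DecidableEq n] [Field K] (A : Matrix m n K)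
    (hA : ∀ y, A.mulVec y = 0 → y = 0) : ∃ L : Matrix n m K, L * A = 1 := by
  obtain ⟨g, hg⟩ := A.toLin'.exists_leftInverse_of_injective
    (LinearMap.ker_eq_bot'.2 fun y hy => hA y hy)
  refine ⟨LinearMap.toMatrix' g, ?_⟩
  rw [← LinearMap.toMatrix'_toLin' A, ← LinearMap.toMatrix'_comp, hg, LinearMap.toMatrix'_id]

theorem volume_le_of_translates_disjoint {n : ℕ} {Y : Set (Fin n → ℝ)} (hY : MeasurableSet Y)
    (hinj : ∀ x ∈ Y, ∀ y ∈ Y, (∃ z : Fin n → ℤ, ∀ i, x i - y i = z i) → x = y)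
    {W : Set (Fin n → ℝ)} (hW : ∀ (x : Fin n → ℝ) (z : Fin n → ℤ), (fun i => x i + z i) ∈ Y → x ∈ W) :
    volume Y ≤ volume (W ∩ univ.pi fun _ => Ioc (0 : ℝ) (0 + 1)) := by
  let τ : (Fin n → ℤ) → (Fin n → ℝ) := fun z i => z i
  let C : Set (Fin n → ℝ) := univ.pi fun _ => Ioc (0 : ℝ) (0 + 1)
  have hC : MeasurableSet C := MeasurableSet.univ_pi fun _ => measurableSet_Ioc
  let Z : (Fin n → ℤ) → Set (Fin n → ℝ) := fun z => C ∩ (fun x => x + τ z) ⁻¹' Y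
  have hZ : ∀ z, MeasurableSet (Z z) := fun z => hC.inter (hY.preimage (by fun_prop))
  have hdis : Pairwise (Function.onFun Disjoint Z) := by
    intro z w hzw
    refine disjoint_left.2 fun x hx hy => hzw ?_
    have := hinj _ hx.2 _ hy.2 ⟨z - w, fun i => by simp [τ]⟩
    ext i
    have := congrFun this i
    simpa [τ] using this
  calc volume Y ≤ volume (⋃ z, (fun x => x + -τ z) ⁻¹' Z z) := by
        refine measure_mono fun x hx => mem_iUnion.2 ⟨fun i => ⌈x i⌉ - 1, ?_, ?_⟩
        · simp only [C, mem_pi, mem_univ, true_imp_iff, mem_Ioc]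
          intro i
          have h1 := Int.ceil_lt_add_one (x i)
          have h2 := Int.le_ceil (x i)
          simp only [τ, Pi.add_apply, Pi.neg_apply]
          push_cast
          constructor <;> linarith
        · simpa using hx
    _ ≤ ∑' z, volume ((fun x => x + -τ z) ⁻¹' Z z) := measure_iUnion_le _
    _ = ∑' z, volume (Z z) := by simp_rw [measure_preimage_add_right]
    _ = volume (⋃ z, Z z) := (measure_iUnion hdis hZ).symm
    _ ≤ _ := by
        refine measure_mono (iUnion_subset fun z x hx => ⟨hW x z hx.2, hx.1⟩)

theorem volume_le_of_translates_disjoint_of_mulVec_le {n k : ℕ} (A : Matrix (Fin n) (Fin k) ℤ)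
    (hA : ∀ y : Fin k → ℝ, (A.map (Int.cast : ℤ → ℝ)).mulVec y = 0 → y = 0) {Y : Set (Fin n → ℝ)}
    (hY : MeasurableSet Y)
    (hinj : ∀ x ∈ Y, ∀ y ∈ Y, (∃ z : Fin n → ℤ, ∀ i, x i - y i = z i) → x = y) {ε : ℝ}
    (hε : ∀ x ∈ Y, ∀ l, |∑ i, A i l * x i| ≤ ε) :
    volume Y ≤ ENNReal.ofReal (2 * ε) ^ k := by
  let f : (Fin n → UnitAddCircle) →+ (Fin k → UnitAddCircle) :=
    AddMonoidHom.mk' (fun ξ l => ∑ i, A i l • ξ i) (by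
      intro a b; ext l; simp [smul_add, Finset.sum_add_distrib])
  have hf : Continuous f := by
    change Continuous fun (ξ : Fin n → UnitAddCircle) l => ∑ i, A i l • ξ i
    fun_prop
  let q : ∀ {m : ℕ}, (Fin m → ℝ) → (Fin m → UnitAddCircle) := fun x i => (x i : UnitAddCircle)
  have hfq : ∀ x : Fin n → ℝ, f (q x) = q fun l => ∑ i, A i l * x i := by
    intro x
    ext l
    change ∑ i, A i l • (x i : UnitAddCircle) = ((∑ i, A i l * x i : ℝ) : UnitAddCircle)
    have : ((∑ i, A i l * x i : ℝ) : UnitAddCircle) =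
      QuotientAddGroup.mk' (AddSubgroup.zmultiples (1 : ℝ)) (∑ i, A i l * x i) := rfl
    rw [this, map_sum]
    refine Finset.sum_congr rfl fun i _ => ?_
    rw [← zsmul_eq_mul, map_zsmul]
    rfl
  have hsurj : Function.Surjective f := by
    intro η
    have hs : Function.Surjective ((A.map (Int.cast : ℤ → ℝ)).transpose.mulVec) := by
      intro y
      obtain ⟨L, hL⟩ := Matrix.exists_left_inverse_of_mulVec_eq_zero _ hA
      refine ⟨L.transpose.mulVec y, ?_⟩
      rw [Matrix.mulVec_mulVec, ← Matrix.transpose_mul, hL, Matrix.transpose_one, Matrix.one_mulVec]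
    choose y hy using fun l => QuotientAddGroup.mk_surjective (η l)
    obtain ⟨x, hx⟩ := hs y
    refine ⟨q x, ?_⟩
    rw [hfq]
    ext l
    rw [← hy l, ← hx]
    rfl
  have hmp : MeasurePreserving f volume volume :=
    AddMonoidHom.measurePreserving hf hsurj (by simp [volume_pi, Measure.pi_univ])
  have hq : MeasurePreserving (q (m := n))
      (volume.restrict (univ.pi fun _ => Ioc (0 : ℝ) (0 + 1))) volume := by
    rw [volume_pi, volume_pi, Measure.restrict_pi_pi]
    exact measurePreserving_pi _ _ fun _ => UnitAddCircle.measurePreserving_mk 0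
  have hB : MeasurableSet (univ.pi fun _ : Fin k => Metric.closedBall (0 : UnitAddCircle) ε) :=
    MeasurableSet.univ_pi fun _ => Metric.isClosed_closedBall.measurableSet
  have h1 := (hmp.comp hq).measure_preimage hB.nullMeasurableSet
  rw [Measure.restrict_apply ((hmp.comp hq).measurable hB)] at h1
  refine (volume_le_of_translates_disjoint hY hinj (W := (f ∘ q) ⁻¹'
    (univ.pi fun _ : Fin k => Metric.closedBall (0 : UnitAddCircle) ε)) ?_).trans (h1.le.trans ?_)
  · intro x z hx
    simp only [mem_preimage, Function.comp_apply, mem_pi, mem_univ, true_imp_iff]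
    intro l
    have e : q x = q fun i => x i + z i := by
      ext i
      change (x i : UnitAddCircle) = ((x i + z i : ℝ) : UnitAddCircle)
      rw [eq_comm, ← sub_eq_zero, ← AddCircle.coe_sub, add_sub_cancel_left]
      exact (AddCircle.coe_eq_zero_iff 1).2 ⟨z i, by simp⟩
    rw [e, hfq, mem_closedBall_zero_iff]
    refine le_trans ?_ (hε _ hx l)
    change ‖((∑ i, A i l * (x i + z i) : ℝ) : UnitAddCircle)‖ ≤ _
    rw [UnitAddCircle.norm_eq]
    exact (round_le _ 0).trans (by simp)
  · rw [volume_pi, Measure.pi_pi]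
    simp only [AddCircle.volume_closedBall, Finset.prod_const, Finset.card_univ, Fintype.card_fin]
    gcongr
    exact min_le_right _ _

/-- The matrix of the linear map `(h, y) ↦ (β j * (⟨A y + h b, v j⟩ + h))_j`. -/
def coneMatrix {n k : ℕ} (v : Fin (n + 1) → Fin n → ℝ) (β : Fin (n + 1) → ℝ)
    (A : Matrix (Fin n) (Fin k) ℝ) (b : Fin n → ℝ) : Matrix (Fin (n + 1)) (Fin (k + 1)) ℝ :=
  Matrix.of fun j => Fin.cons (β j * (1 + ∑ i, b i * v j i)) fun l => β j * ∑ i, v j i * A i l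

theorem coneMatrix_one_eq_mul {n : ℕ} (v : Fin (n + 1) → Fin n → ℝ) (β : Fin (n + 1) → ℝ)
    (b : Fin n → ℝ) : coneMatrix v β 1 b = coneMatrix v β 1 0 *
      (Matrix.of (fun i => Fin.cons ((Fin.cons 1 b : Fin (n + 1) → ℝ) i)
        fun l => if i = Fin.succ l then 1 else 0) : Matrix (Fin (n + 1)) (Fin (n + 1)) ℝ) := by
  ext j l
  rw [Matrix.mul_apply, Fin.sum_univ_succ]
  refine Fin.cases ?_ (fun l => ?_) l
  · simp [coneMatrix, Matrix.one_apply, mul_add, Finset.mul_sum]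
    exact Finset.sum_congr rfl fun i _ => by ring
  · simp [coneMatrix, Matrix.one_apply, (Fin.succ_ne_zero l).symm]

theorem det_coneMatrix_one {n : ℕ} (v : Fin (n + 1) → Fin n → ℝ) (β : Fin (n + 1) → ℝ)
    (b : Fin n → ℝ) : (coneMatrix v β 1 b).det = (coneMatrix v β 1 0).det := by
  rw [coneMatrix_one_eq_mul, Matrix.det_mul]
  convert mul_one _
  rw [Matrix.det_of_isLowerTriangular]
  · refine Finset.prod_eq_one fun i _ => ?_
    refine Fin.cases ?_ (fun i => ?_) i <;> simp
  · intro i j hij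
    have hij' : i < j := hij
    revert hij'
    refine Fin.cases ?_ (fun l => ?_) j
    · intro h; exact absurd h (Fin.not_lt_zero _)
    · intro h; simp [h.ne]

theorem volume_slab_mul_det_le {n k : ℕ} (v : Fin (n + 1) → Fin n → ℝ) (β : Fin (n + 1) → ℝ)
    (A : Matrix (Fin n) (Fin k) ℤ) (b : Fin n → ℝ)
    (hA : ∀ y : Fin k → ℝ, (A.map (Int.cast : ℤ → ℝ)).mulVec y = 0 → y = 0)
    (hlat : ∀ (z : Fin n → ℤ) (δ : Fin (n + 1) → ℝ), (∀ j, |δ j| < 1) →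
      (∀ i, (z i : ℝ) = ∑ j, β j * v j i * δ j) → z = 0) (ε : ℝ) :
    volume {p : Fin (n + 1) → ℝ | (∀ j, |p j| < 1 / 2) ∧ ∀ l,
        |((coneMatrix v β (A.map (Int.cast : ℤ → ℝ)) b).transpose.mulVec p) l| ≤ ε} *
      ENNReal.ofReal |(coneMatrix v β 1 0).det| ≤ ENNReal.ofReal (2 * ε) ^ (k + 1) := by
  rcases eq_or_ne (coneMatrix v β 1 0).det 0 with h0 | h0
  · simp [h0]
  set G := coneMatrix v β (A.map (Int.cast : ℤ → ℝ)) b with hG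
  set E := {p : Fin (n + 1) → ℝ | (∀ j, |p j| < 1 / 2) ∧ ∀ l, |(G.transpose.mulVec p) l| ≤ ε}
    with hE
  have hEm : MeasurableSet E := by
    rw [hE, Set.ofPred_and, Set.ofPred_forall, Set.ofPred_forall]
    refine (MeasurableSet.iInter fun i => measurableSet_lt (by fun_prop) (by fun_prop)).inter
      (MeasurableSet.iInter fun i => measurableSet_le ?_ (by fun_prop))
    exact (Continuous.abs (by fun_prop)).measurable
  set M := (coneMatrix (k := n) v β 1 b).transpose with hM
  have hMdet : M.det = (coneMatrix v β 1 0).det := by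
    rw [hM, Matrix.det_transpose, det_coneMatrix_one]
  have hMu : IsUnit M.det := by rw [hMdet]; exact h0.isUnit
  set Q := (fun q => M⁻¹.mulVec q) ⁻¹' E with hQ
  have hQm : MeasurableSet Q := hEm.preimage (Continuous.measurable (by fun_prop))
  have hvolQ : volume Q = volume E * ENNReal.ofReal |(coneMatrix v β 1 0).det| := by
    have := Measure.addHaar_preimage_linearMap volume (f := M⁻¹.toLin')
      (by rw [LinearMap.det_toLin', Matrix.det_nonsing_inv, Ring.inverse_eq_inv', hMdet]
          exact inv_ne_zero h0) E
    rw [LinearMap.det_toLin', Matrix.det_nonsing_inv, Ring.inverse_eq_inv', hMdet, inv_inv,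
      mul_comm] at this
    exact this
  rw [← hvolQ]
  have hcomp : ∀ q ∈ Q, |q 0| ≤ ε ∧ (∀ l, |∑ i, A i l * q (Fin.succ i)| ≤ ε) ∧
      ∃ p : Fin (n + 1) → ℝ, (∀ j, |p j| < 1 / 2) ∧
        ∀ i, q (Fin.succ i) = ∑ j, β j * v j i * p j := by
    intro q hq
    have hq1 := hq.1
    have hq2 := hq.2
    have hqp : M.mulVec (M⁻¹.mulVec q) = q := by
      rw [Matrix.mulVec_mulVec, Matrix.mul_nonsing_inv _ hMu, Matrix.one_mulVec]
    simp only at hq1 hq2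
    generalize M⁻¹.mulVec q = p at *
    have hqs : ∀ i, q (Fin.succ i) = ∑ j, β j * v j i * p j := by
      intro i
      rw [← hqp]
      simp [hM, Matrix.mulVec, dotProduct, coneMatrix, Matrix.one_apply]
    refine ⟨?_, fun l => ?_, p, hq1, hqs⟩
    · convert hq2 0 using 2
      rw [← hqp]
      simp [hM, hG, Matrix.mulVec, dotProduct, coneMatrix]
    · convert hq2 (Fin.succ l) using 2
      simp only [hqs, hG, Matrix.mulVec, dotProduct, coneMatrix, Matrix.transpose_apply,
        Matrix.of_apply, Fin.cons_succ, Matrix.map_apply, Finset.mul_sum, Finset.sum_mul]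
      rw [Finset.sum_comm]
      exact Finset.sum_congr rfl fun i _ => Finset.sum_congr rfl fun j _ => by ring
  have hvp := (volume_preserving_piFinSuccAbove (fun _ : Fin (n + 1) => ℝ) 0).symm
  rw [← hvp.measure_preimage hQm.nullMeasurableSet, Measure.volume_eq_prod,
    Measure.prod_apply (hvp.measurable hQm)]
  have hslice : ∀ c, volume (Prod.mk c ⁻¹' ((MeasurableEquiv.piFinSuccAbove
      (fun _ : Fin (n + 1) => ℝ) 0).symm ⁻¹' Q)) ≤
      (Icc (-ε) ε).indicator (fun _ => ENNReal.ofReal (2 * ε) ^ k) c := by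
    intro c
    by_cases hc : c ∈ Icc (-ε) ε
    · rw [indicator_of_mem hc]
      refine volume_le_of_translates_disjoint_of_mulVec_le A hA
        ((hvp.measurable hQm).preimage measurable_prodMk_left) ?_ ?_
      · rintro x hx y hy ⟨z, hz⟩
        obtain ⟨-, -, p, hp, hpx⟩ := hcomp _ hx
        obtain ⟨-, -, r, hr, hry⟩ := hcomp _ hy
        have : z = 0 := by
          refine hlat z (p - r) (fun j => ?_) fun i => ?_
          · have h1 := abs_lt.1 (hp j)
            have h2 := abs_lt.1 (hr j)
            rw [Pi.sub_apply, abs_lt]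
            constructor <;> linarith
          · have h1 := hpx i
            have h2 := hry i
            simp only [MeasurableEquiv.piFinSuccAbove_symm_apply] at h1 h2
            rw [← hz]
            simp only [Pi.sub_apply, mul_sub, Finset.sum_sub_distrib, ← h1, ← h2]
            simp
        ext i
        have := hz i
        simp_all [sub_eq_zero]
      · intro x hx l
        simpa using (hcomp _ hx).2.1 l
    · rw [indicator_of_notMem hc, nonpos_iff_eq_zero]
      convert measure_empty (μ := (volume : Measure (Fin n → ℝ)))
      ext x
      simp only [mem_empty_iff_false, iff_false]
      intro hx
      apply hc
      have := (hcomp _ hx).1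
      rw [abs_le] at this
      simpa using this
  refine (lintegral_mono hslice).trans ?_
  rw [lintegral_indicator measurableSet_Icc, setLIntegral_const, Real.volume_Icc, pow_succ]
  gcongr
  linarith

/-- The standard Gaussian weight `exp (-π |p|²)`. -/
noncomputable def gaussWeight {ι : Type*} [Fintype ι] (p : ι → ℝ) : ℝ≥0∞ :=
  ENNReal.ofReal (Real.exp (-Real.pi * ∑ i, p i ^ 2))

section

variable {ι κ : Type*} [Fintype ι] [Fintype κ]

theorem measurable_gaussWeight : Measurable (gaussWeight (ι := ι)) := by
  unfold gaussWeight
  fun_prop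

theorem lintegral_gaussWeight : ∫⁻ p : ι → ℝ, gaussWeight p = 1 := by
  have h := GaussianFourier.integral_rexp_neg_mul_sq_norm (V := EuclideanSpace ℝ ι) Real.pi_pos
  rw [div_self Real.pi_ne_zero, Real.one_rpow] at h
  have hi : Integrable fun v : EuclideanSpace ℝ ι => Real.exp (-Real.pi * ‖v‖ ^ 2) :=
    Integrable.of_integral_ne_zero (by rw [h]; exact one_ne_zero)
  have h2 := ofReal_integral_eq_lintegral_ofReal hi (Filter.Eventually.of_forall fun _ => by positivity)
  rw [h, ENNReal.ofReal_one] at h2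
  rw [h2, ← (PiLp.volume_preserving_ofLp ι).lintegral_comp measurable_gaussWeight]
  refine lintegral_congr fun v => ?_
  simp [gaussWeight, EuclideanSpace.norm_sq_eq]

theorem prod_ofReal_exp_neg_pi (p : ι → ℝ) :
    ∏ i, ENNReal.ofReal (Real.exp (-Real.pi * p i ^ 2)) = gaussWeight p := by
  rw [gaussWeight, ← ENNReal.ofReal_prod_of_nonneg fun _ _ => by positivity, ← Real.exp_sum,
    Finset.mul_sum]

/-- The Gaussian measure is invariant under orthogonal projections. -/
theorem lintegral_comp_transpose_mulVec_mul_gaussWeight [DecidableEq κ] (O : Matrix ι κ ℝ)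
    (hO : O.transpose * O = 1) {F : (κ → ℝ) → ℝ≥0∞} (hF : Measurable F) :
    ∫⁻ p, F (O.transpose.mulVec p) * gaussWeight p = ∫⁻ u, F u * gaussWeight u := by
  classical
  let o : κ → EuclideanSpace ℝ ι := fun c => WithLp.toLp 2 fun i => O i c
  have ho : Orthonormal ℝ o := by
    rw [orthonormal_iff_ite]
    intro c d
    have := congrFun (congrFun hO d) c
    rw [Matrix.mul_apply, Matrix.one_apply] at this
    simp only [Matrix.transpose_apply] at this
    rw [PiLp.inner_apply]
    simp only [o, RCLike.inner_apply, conj_trivial, this, eq_comm]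
  have hle : Fintype.card κ ≤ Fintype.card ι := by
    simpa using ho.linearIndependent.fintype_card_le_finrank
  let μ := Fin (Fintype.card ι - Fintype.card κ)
  obtain ⟨b, hb⟩ := Orthonormal.exists_orthonormalBasis_extension_of_card_eq (𝕜 := ℝ) (ι := κ ⊕ μ)
    (E := EuclideanSpace ℝ ι) (by simp [μ, hle]) (v := Sum.elim o 0) (s := range Sum.inl) (by
      have e : (range (Sum.inl : κ → κ ⊕ μ)).domRestrict (Sum.elim o 0) =
          o ∘ (Equiv.ofInjective _ Sum.inl_injective).symm := by
        funext ⟨_, c, rfl⟩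
        have e : (Equiv.ofInjective (Sum.inl : κ → κ ⊕ μ) Sum.inl_injective).symm
            ⟨Sum.inl c, c, rfl⟩ = c := Equiv.ofInjective_symm_apply Sum.inl_injective c
        rw [Function.comp_apply, e]
        rfl
      rw [e]
      exact ho.comp _ (Equiv.injective _))
  have hmp := ((volume_measurePreserving_sumPiEquivProdPi fun _ : κ ⊕ μ => ℝ).comp
    (PiLp.volume_preserving_ofLp (κ ⊕ μ))).comp
    (b.measurePreserving_repr.comp (PiLp.volume_preserving_toLp ι))
  have hF2 : Measurable fun q : (κ → ℝ) × (μ → ℝ) => (F q.1 * gaussWeight q.1) * gaussWeight q.2 :=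
    ((hF.comp measurable_fst).mul (measurable_gaussWeight.comp measurable_fst)).mul
      (measurable_gaussWeight.comp measurable_snd)
  have h := hmp.lintegral_comp hF2
  rw [Measure.volume_eq_prod, lintegral_prod_mul
    (f := fun u : κ → ℝ => F u * gaussWeight u) (g := gaussWeight)
    (hF.mul measurable_gaussWeight).aemeasurable measurable_gaussWeight.aemeasurable,
    lintegral_gaussWeight, mul_one] at h
  rw [← h]
  refine lintegral_congr fun p => ?_
  have h1 : ∀ c, b.repr (WithLp.toLp 2 p) (Sum.inl c) = (O.transpose.mulVec p) c := by
    intro c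
    rw [OrthonormalBasis.repr_apply_apply, hb _ ⟨c, rfl⟩, PiLp.inner_apply]
    simp [o, Matrix.mulVec, dotProduct, mul_comm]
  have h2 : ∑ i, p i ^ 2 = ∑ c, (b.repr (WithLp.toLp 2 p) (Sum.inl c)) ^ 2 +
      ∑ c, (b.repr (WithLp.toLp 2 p) (Sum.inr c)) ^ 2 := by
    have := b.repr.norm_map (WithLp.toLp 2 p)
    rw [← sq_eq_sq₀ (norm_nonneg _) (norm_nonneg _), EuclideanSpace.norm_sq_eq,
      EuclideanSpace.norm_sq_eq, Fintype.sum_sum_type] at this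
    simpa using this.symm
  change _ = F (fun c => b.repr (WithLp.toLp 2 p) (Sum.inl c)) *
    gaussWeight (fun c => b.repr (WithLp.toLp 2 p) (Sum.inl c)) *
    gaussWeight (fun c => b.repr (WithLp.toLp 2 p) (Sum.inr c))
  rw [mul_assoc]
  congr 1
  · congr 1
    exact (funext h1).symm
  · rw [gaussWeight, gaussWeight, gaussWeight, ← ENNReal.ofReal_mul (by positivity), ← Real.exp_add,
      ← mul_add, h2]

theorem isLogConcave_exp_neg_mul_sq {c : ℝ} (hc : 0 ≤ c) :
    IsLogConcave fun x : ℝ => ENNReal.ofReal (Real.exp (-c * x ^ 2)) := by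
  intro x y a b ha hb hab
  rw [ENNReal.ofReal_rpow_of_nonneg (by positivity) ha.le,
    ENNReal.ofReal_rpow_of_nonneg (by positivity) hb.le, ← ENNReal.ofReal_mul (by positivity),
    ← Real.exp_mul, ← Real.exp_mul, ← Real.exp_add]
  refine ENNReal.ofReal_le_ofReal (Real.exp_le_exp.2 ?_)
  obtain rfl : b = 1 - a := by linarith
  simp only [smul_eq_mul]
  have : 0 ≤ c * (a * (1 - a) * (x - y) ^ 2) := by positivity
  nlinarith

theorem lintegral_exp_neg_pi_mul_sq :
    ∫⁻ x : ℝ, ENNReal.ofReal (Real.exp (-Real.pi * x ^ 2)) = 1 := by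
  have h := integral_gaussian Real.pi
  rw [div_self Real.pi_ne_zero, Real.sqrt_one] at h
  rw [← ofReal_integral_eq_lintegral_ofReal (integrable_exp_neg_mul_sq Real.pi_pos)
    (Filter.Eventually.of_forall fun _ => by positivity), h, ENNReal.ofReal_one]

theorem setLIntegral_gaussWeight_le {A : Set (ι → ℝ)} (hA : Convex ℝ A)
    (hAm : MeasurableSet A) (hAs : ∀ x ∈ A, -x ∈ A) :
    ∫⁻ p in A, gaussWeight p ≤ volume (A ∩ {p | ∀ i, |p i| < 1 / 2}) := by
  simp_rw [← prod_ofReal_exp_neg_pi]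
  refine lintegral_indicator_mul_prod_le (by fun_prop) (isLogConcave_exp_neg_mul_sq Real.pi_pos.le)
    (by simp) (fun x => ?_) lintegral_exp_neg_pi_mul_sq hA hAm hAs
  rw [ENNReal.ofReal_le_one, Real.exp_le_one_iff]
  have := Real.pi_pos
  nlinarith [sq_nonneg x]

end

theorem mul_abs_det_le_one_of_volume_slab_le {ι κ : Type*} [Fintype ι] [Fintype κ] [DecidableEq κ]
    (G : Matrix ι κ ℝ) (R : Matrix κ κ ℝ) (hO : (G * R).transpose * (G * R) = 1) {D : ℝ}
    (hD : 0 ≤ D) (h : ∀ ε > 0, volume {p : ι → ℝ | (∀ j, |p j| < 1 / 2) ∧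
      ∀ l, |(G.transpose.mulVec p) l| ≤ ε} * ENNReal.ofReal D ≤
        ENNReal.ofReal (2 * ε) ^ Fintype.card κ) : D * |R.det| ≤ 1 := by
  have hR : IsUnit R.transpose.det := by
    have := congrArg Matrix.det hO
    rw [Matrix.transpose_mul, Matrix.mul_assoc, Matrix.det_mul, Matrix.det_one] at this
    exact IsUnit.of_mul_eq_one _ this
  have hR0 : R.det ≠ 0 := by rw [← Matrix.det_transpose]; exact hR.ne_zero
  set C : ℝ := ∑ c, (∑ l, |R l c|) ^ 2 with hC
  have main : ∀ ε > 0, D * (|R.det| * Real.exp (-Real.pi * (C * ε ^ 2))) ≤ 1 := by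
    intro ε hε
    set A : Set (ι → ℝ) := {p | ∀ l, |(G.transpose.mulVec p) l| ≤ ε} with hA
    have hAc : Convex ℝ A := by
      intro x hx y hy a b ha hb hab l
      have h1 := hx l
      have h2 := hy l
      rw [Matrix.mulVec_add, Matrix.mulVec_smul, Matrix.mulVec_smul]
      simp only [Pi.add_apply, Pi.smul_apply, smul_eq_mul]
      calc _ ≤ a * |(G.transpose.mulVec x) l| + b * |(G.transpose.mulVec y) l| := by
            refine (abs_add_le _ _).trans ?_
            rw [abs_mul, abs_mul, abs_of_nonneg ha, abs_of_nonneg hb]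
        _ ≤ a * ε + b * ε := by gcongr
        _ = ε := by rw [← add_mul, hab, one_mul]
    have hAm : MeasurableSet A := by
      rw [hA, Set.ofPred_forall]
      refine MeasurableSet.iInter fun i => measurableSet_le ?_ (by fun_prop)
      exact (Continuous.abs (by fun_prop)).measurable
    have hAs : ∀ x ∈ A, -x ∈ A := by
      intro x hx l
      rw [Matrix.mulVec_neg, Pi.neg_apply, abs_neg]
      exact hx l
    set U : Set (κ → ℝ) := (fun u => (R.transpose⁻¹).mulVec u) ⁻¹' univ.pi fun _ => Icc (-ε) ε
      with hU
    have hUm : MeasurableSet U := (MeasurableSet.univ_pi fun _ => measurableSet_Icc).preimage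
      (Continuous.measurable (by fun_prop))
    have hUvol : volume U = ENNReal.ofReal |R.det| * ENNReal.ofReal (2 * ε) ^ Fintype.card κ := by
      have := Measure.addHaar_preimage_linearMap volume (f := (R.transpose⁻¹).toLin')
        (by rw [LinearMap.det_toLin', Matrix.det_nonsing_inv, Ring.inverse_eq_inv',
              Matrix.det_transpose]
            exact inv_ne_zero hR0) (univ.pi fun _ => Icc (-ε) ε)
      rw [LinearMap.det_toLin', Matrix.det_nonsing_inv, Ring.inverse_eq_inv', Matrix.det_transpose,
        inv_inv, volume_pi, Measure.pi_pi] at this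
      refine this.trans ?_
      simp only [Real.volume_Icc, Finset.prod_const, Finset.card_univ]
      congr 3
      ring
    have hAU : ∀ p, p ∈ A ↔ (G * R).transpose.mulVec p ∈ U := by
      intro p
      simp only [hA, hU, mem_preimage, Matrix.mulVec_mulVec, Matrix.transpose_mul]
      rw [← Matrix.mul_assoc, Matrix.nonsing_inv_mul _ hR, Matrix.one_mul]
      simp only [mem_pi, mem_univ, true_imp_iff, mem_Icc, abs_le, mem_ofPred_eq]
    have e1 : ∫⁻ p in A, gaussWeight p = ∫⁻ u in U, gaussWeight u := by
      have := lintegral_comp_transpose_mulVec_mul_gaussWeight (G * R) hO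
        (F := U.indicator 1) (measurable_one.indicator hUm)
      rw [← lintegral_indicator hAm, ← lintegral_indicator hUm]
      convert this using 1
      · refine lintegral_congr fun p => ?_
        by_cases hp : p ∈ A
        · rw [indicator_of_mem hp, indicator_of_mem ((hAU p).1 hp)]; simp
        · rw [indicator_of_notMem hp, indicator_of_notMem (mt (hAU p).2 hp)]; simp
      · refine lintegral_congr fun p => ?_
        by_cases hp : p ∈ U <;> simp [hp]
    have e2 : volume U * ENNReal.ofReal (Real.exp (-Real.pi * (C * ε ^ 2))) ≤
        ∫⁻ u in U, gaussWeight u := by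
      rw [mul_comm, ← setLIntegral_const]
      refine setLIntegral_mono' hUm fun u hu => ENNReal.ofReal_le_ofReal (Real.exp_le_exp.2 ?_)
      rw [neg_mul, neg_mul, neg_le_neg_iff]
      refine mul_le_mul_of_nonneg_left ?_ Real.pi_pos.le
      rw [hC, Finset.sum_mul]
      refine Finset.sum_le_sum fun c _ => ?_
      rw [← mul_pow]
      refine sq_le_sq.2 ?_
      rw [abs_of_nonneg (a := (∑ l, |R l c|) * ε) (by positivity)]
      have hu' : R.transpose.mulVec ((R.transpose⁻¹).mulVec u) = u := by
        rw [Matrix.mulVec_mulVec, Matrix.mul_nonsing_inv _ hR, Matrix.one_mulVec]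
      rw [← hu', Matrix.mulVec, dotProduct, Finset.sum_mul]
      refine (Finset.abs_sum_le_sum_abs _ _).trans (Finset.sum_le_sum fun l _ => ?_)
      rw [abs_mul, Matrix.transpose_apply]
      gcongr
      exact abs_le.2 (hu l (mem_univ l))
    have e3 := (e2.trans e1.ge).trans (setLIntegral_gaussWeight_le hAc hAm hAs)
    have e4 : A ∩ {p | ∀ i, |p i| < 1 / 2} = {p : ι → ℝ | (∀ j, |p j| < 1 / 2) ∧
      ∀ l, |(G.transpose.mulVec p) l| ≤ ε} := by
      rw [inter_comm]; rfl
    rw [e4] at e3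
    have e5 := (mul_le_mul_left e3 (ENNReal.ofReal D)).trans (h ε hε)
    rw [hUvol] at e5
    set K := ENNReal.ofReal (2 * ε) ^ Fintype.card κ with hK
    have hK0 : K ≠ 0 := by simp [hK, hε]
    have hKt : K ≠ ∞ := ENNReal.pow_ne_top ENNReal.ofReal_ne_top
    have e6 : K * ENNReal.ofReal (D * (|R.det| * Real.exp (-Real.pi * (C * ε ^ 2)))) ≤ K * 1 := by
      rw [ENNReal.ofReal_mul hD, ENNReal.ofReal_mul (abs_nonneg _), mul_one]
      refine le_trans (le_of_eq ?_) e5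
      ring
    have e7 := (ENNReal.mul_le_mul_iff_right hK0 hKt).1 e6
    rwa [ENNReal.ofReal_le_one] at e7
  have hlim : Filter.Tendsto (fun ε : ℝ => D * (|R.det| * Real.exp (-Real.pi * (C * ε ^ 2))))
      (nhdsWithin 0 (Ioi 0)) (nhds (D * |R.det|)) := by
    have : Continuous fun ε : ℝ => D * (|R.det| * Real.exp (-Real.pi * (C * ε ^ 2))) := by fun_prop
    have := (this.tendsto 0).mono_left (nhdsWithin_le_nhds (s := Ioi 0))
    simpa using this
  refine le_of_tendsto hlim ?_
  filter_upwards [self_mem_nhdsWithin] with ε hε using main ε hε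

/-- The increasing transport from the exponential law on `(0, ∞)` to the Gaussian law. -/
theorem exists_strictMonoOn_hasDerivAt_exp :
    ∃ T : ℝ → ℝ, StrictMonoOn T (Ioi 0) ∧
      ∀ s > 0, HasDerivAt T (Real.exp (Real.pi * T s ^ 2 - s)) s := by
  have hgi : Integrable fun x : ℝ => Real.exp (-Real.pi * x ^ 2) :=
    integrable_exp_neg_mul_sq Real.pi_pos
  have hg1 : ∫ x : ℝ, Real.exp (-Real.pi * x ^ 2) = 1 := by
    rw [integral_gaussian, div_self Real.pi_ne_zero, Real.sqrt_one]
  have hgc : Continuous fun x : ℝ => Real.exp (-Real.pi * x ^ 2) := by fun_prop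
  set Φ : ℝ → ℝ := fun x => ∫ v in Iic x, Real.exp (-Real.pi * v ^ 2) with hΦ
  have hΦ0 : Φ = fun x => (∫ v in (0 : ℝ)..x, Real.exp (-Real.pi * v ^ 2)) + Φ 0 := by
    funext x
    rw [← intervalIntegral.integral_Iic_sub_Iic hgi.integrableOn hgi.integrableOn, hΦ]
    ring
  have hder : ∀ x, HasDerivAt Φ (Real.exp (-Real.pi * x ^ 2)) x := by
    intro x
    rw [hΦ0]
    exact (intervalIntegral.integral_hasDerivAt_right (hgi.intervalIntegrable)
      hgc.stronglyMeasurable.stronglyMeasurableAtFilter hgc.continuousAt).add_const _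
  have hmono : StrictMono Φ := strictMono_of_deriv_pos fun x => by
    rw [(hder x).deriv]; exact Real.exp_pos _
  have htop : Filter.Tendsto Φ Filter.atTop (nhds 1) := by
    rw [← hg1]
    exact (aecover_Iic Filter.tendsto_id).integral_tendsto_of_countably_generated hgi
  have hbot : Filter.Tendsto Φ Filter.atBot (nhds 0) := by
    have h := (aecover_Ioi (μ := volume) (l := Filter.atBot) (a := (id : ℝ → ℝ))
      Filter.tendsto_id).integral_tendsto_of_countably_generated hgi
    have h2 := h.const_sub 1
    rw [hg1, sub_self] at h2
    refine h2.congr fun x => ?_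
    rw [sub_eq_iff_eq_add, ← hg1]
    exact (intervalIntegral.integral_Iic_add_Ioi hgi.integrableOn hgi.integrableOn).symm
  have hΦc : Continuous Φ := continuous_iff_continuousAt.2 fun x => (hder x).continuousAt
  have hlt : ∀ x, Φ x < 1 := fun x =>
    (hmono (lt_add_one x)).trans_le (hmono.monotone.ge_of_tendsto htop _)
  have hgt : ∀ x, 0 < Φ x := fun x =>
    (hmono.monotone.le_of_tendsto hbot _).trans_lt (hmono (sub_one_lt x))
  have hex : ∀ s : ℝ, ∃ x, 0 < s → Φ x = 1 - Real.exp (-s) := by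
    intro s
    by_cases hs : 0 < s
    · have h1 : 1 - Real.exp (-s) < 1 := by linarith [Real.exp_pos (-s)]
      have h0 : 0 < 1 - Real.exp (-s) := by
        have : Real.exp (-s) < 1 := by rw [← Real.exp_zero]; exact Real.exp_lt_exp.2 (by linarith)
        linarith
      obtain ⟨x, hx⟩ := mem_range_of_exists_le_of_exists_ge hΦc
        ((hbot.eventually (gt_mem_nhds h0)).exists.imp fun _ h => h.le)
        ((htop.eventually (lt_mem_nhds h1)).exists.imp fun _ h => h.le)
      exact ⟨x, fun _ => hx⟩
    · exact ⟨0, fun h => absurd h hs⟩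
  choose T hT using hex
  have hTmono : StrictMonoOn T (Ioi 0) := by
    intro s hs s' hs' hss
    rw [← hmono.lt_iff_lt, hT s hs, hT s' hs']
    have := Real.exp_lt_exp.2 (neg_lt_neg hss)
    linarith
  have himage : T '' Ioi 0 = univ := by
    refine eq_univ_of_forall fun x => ?_
    have h1 : 0 < 1 - Φ x := by linarith [hlt x]
    have hs : 0 < -Real.log (1 - Φ x) := by
      have := Real.log_neg h1 (by linarith [hgt x])
      linarith
    refine ⟨_, hs, hmono.injective ?_⟩
    rw [hT _ hs, neg_neg, Real.exp_log h1]
    ring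
  refine ⟨T, hTmono, fun s hs => ?_⟩
  have hTc : ContinuousAt T s := hTmono.continuousAt_of_image_mem_nhds (Ioi_mem_nhds hs)
    (by rw [himage]; exact Filter.univ_mem)
  have hcomp : HasDerivAt (fun x => -Real.log (1 - Φ x))
      (Real.exp (-Real.pi * T s ^ 2) / (1 - Φ (T s))) (T s) := by
    have h := (((hder (T s)).const_sub 1).log (by linarith [hlt (T s)])).neg
    exact h.congr_deriv (by rw [neg_div, neg_neg])
  have hinv := HasDerivAt.of_local_left_inverse hTc hcomp
    (div_ne_zero (Real.exp_pos _).ne' (by linarith [hlt (T s)])) (by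
      filter_upwards [Ioi_mem_nhds hs] with y hy
      rw [hT y hy, sub_sub_cancel, Real.log_exp, neg_neg])
  refine hinv.congr_deriv ?_
  rw [inv_div, hT s hs, sub_sub_cancel, ← Real.exp_sub]
  congr 1
  ring

section

variable {ι κ : Type*} [Fintype ι] [Fintype κ] [DecidableEq κ]

/-- Ball's determinant inequality. -/
theorem prod_rpow_le_det_transpose_mul_diagonal_mul [DecidableEq ι] (O : Matrix ι κ ℝ)
    (hO : O.transpose * O = 1) (w : ι → ℝ) (hw : ∀ a, 0 ≤ w a) :
    ∏ a, w a ^ (∑ l, O a l ^ 2) ≤ (O.transpose * Matrix.diagonal w * O).det := by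
  set M := O.transpose * Matrix.diagonal w * O with hM
  have hMh : M.IsHermitian := by
    rw [Matrix.IsHermitian, Matrix.conjTranspose_eq_transpose_of_trivial, hM]
    simp [Matrix.transpose_mul, Matrix.mul_assoc]
  set V : Matrix κ κ ℝ := (hMh.eigenvectorUnitary : Matrix κ κ ℝ) with hV
  have hV1 : V.transpose * V = 1 := by
    have := Unitary.coe_star_mul_self hMh.eigenvectorUnitary
    rwa [Matrix.star_eq_conjTranspose, Matrix.conjTranspose_eq_transpose_of_trivial] at this
  have hV2 : V * V.transpose = 1 := by
    rwa [mul_eq_one_comm]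
  have hdiag : (O * V).transpose * Matrix.diagonal w * (O * V) =
      Matrix.diagonal hMh.eigenvalues := by
    have h := hMh.spectral_theorem
    rw [Unitary.conjStarAlgAut_apply, Matrix.star_eq_conjTranspose,
      Matrix.conjTranspose_eq_transpose_of_trivial, ← hV] at h
    calc _ = V.transpose * M * V := by rw [hM, Matrix.transpose_mul]; simp only [Matrix.mul_assoc]
      _ = V.transpose * (V * Matrix.diagonal (RCLike.ofReal ∘ hMh.eigenvalues) * V.transpose) * V := by
        rw [← h]
      _ = (V.transpose * V) * Matrix.diagonal (RCLike.ofReal ∘ hMh.eigenvalues) *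
          (V.transpose * V) := by simp only [Matrix.mul_assoc]
      _ = _ := by rw [hV1, Matrix.one_mul, Matrix.mul_one]; rfl
  have hQ : (O * V).transpose * (O * V) = 1 := by
    rw [Matrix.transpose_mul, Matrix.mul_assoc, ← Matrix.mul_assoc _ O, hO, Matrix.one_mul, hV1]
  have hQ2 : (O * V) * (O * V).transpose = O * O.transpose := by
    rw [Matrix.transpose_mul, Matrix.mul_assoc, ← Matrix.mul_assoc V, hV2, Matrix.one_mul]
  generalize O * V = Q at hdiag hQ hQ2
  have hrow : ∀ a, ∑ l, O a l ^ 2 = ∑ l, Q a l ^ 2 := by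
    intro a
    have := congrFun (congrFun hQ2 a) a
    simpa [Matrix.mul_apply, ← sq] using this.symm
  have hcol : ∀ l, ∑ a, Q a l ^ 2 = 1 := by
    intro l
    have := congrFun (congrFun hQ l) l
    simpa [Matrix.mul_apply, ← sq] using this
  have heig : ∀ l, hMh.eigenvalues l = ∑ a, Q a l ^ 2 * w a := by
    intro l
    have := congrFun (congrFun hdiag l) l
    rw [Matrix.diagonal_apply_eq, Matrix.mul_apply] at this
    rw [← this]
    refine Finset.sum_congr rfl fun a _ => ?_
    rw [Matrix.mul_diagonal, Matrix.transpose_apply]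
    ring
  rw [hMh.det_eq_prod_eigenvalues]
  calc ∏ a, w a ^ (∑ l, O a l ^ 2) = ∏ a, ∏ l, w a ^ (Q a l ^ 2) := by
        refine Finset.prod_congr rfl fun a _ => ?_
        rw [hrow, Real.rpow_sum_of_nonneg (hw a) fun _ _ => sq_nonneg _]
    _ = ∏ l, ∏ a, w a ^ (Q a l ^ 2) := Finset.prod_comm
    _ ≤ ∏ l, hMh.eigenvalues l := by
        refine Finset.prod_le_prod (fun l _ => Finset.prod_nonneg fun a _ =>
          Real.rpow_nonneg (hw a) _) fun l _ => ?_
        rw [heig]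
        exact Real.geom_mean_le_arith_mean_weighted _ _ _ (fun _ _ => sq_nonneg _) (hcol l)
          fun a _ => hw a
    _ = _ := rfl

theorem sum_sq_transpose_mulVec_le (O : Matrix ι κ ℝ) (hO : O.transpose * O = 1) (u : ι → ℝ) :
    ∑ l, (O.transpose.mulVec u) l ^ 2 ≤ ∑ a, u a ^ 2 := by
  set x := O.transpose.mulVec u with hx
  have h1 : ∑ a, u a * (O.mulVec x) a = ∑ l, x l ^ 2 := by
    change u ⬝ᵥ O.mulVec x = _
    rw [Matrix.dotProduct_mulVec, ← Matrix.mulVec_transpose, ← hx]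
    simp [dotProduct, sq]
  have h2 : ∑ a, (O.mulVec x) a ^ 2 = ∑ l, x l ^ 2 := by
    have : O.mulVec x ⬝ᵥ O.mulVec x = x ⬝ᵥ x := by
      rw [Matrix.dotProduct_mulVec, ← Matrix.mulVec_transpose, Matrix.mulVec_mulVec, hO,
        Matrix.one_mulVec]
    simpa [dotProduct, sq] using this
  have h3 : 0 ≤ ∑ a, (u a - (O.mulVec x) a) ^ 2 := Finset.sum_nonneg fun _ _ => sq_nonneg _
  simp only [sub_sq, Finset.sum_add_distrib, Finset.sum_sub_distrib, mul_assoc,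
    ← Finset.mul_sum] at h3
  rw [h1, h2] at h3
  linarith

theorem sum_sq_row_le_one (O : Matrix ι κ ℝ) (hO : O.transpose * O = 1) (a : ι) :
    ∑ l, O a l ^ 2 ≤ 1 := by
  classical
  have := sum_sq_transpose_mulVec_le O hO (Pi.single a 1)
  simpa [Pi.single_apply] using this

end

section

variable {ι κ : Type*} [Fintype ι] [Fintype κ] [DecidableEq κ]

omit [Fintype ι] in
theorem volume_mulVec_apply_eq_zero (O : Matrix ι κ ℝ) (a : ι) (ha : ∑ l, O a l ^ 2 ≠ 0) :
    volume {y : κ → ℝ | (O.mulVec y) a = 0} = 0 := by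
  have := Measure.addHaar_submodule (volume : Measure (κ → ℝ))
    (LinearMap.ker ((LinearMap.proj a).comp O.mulVecLin : (κ → ℝ) →ₗ[ℝ] ℝ)) (by
      intro h
      apply ha
      refine Finset.sum_eq_zero fun l _ => ?_
      have : Pi.single l (1 : ℝ) ∈
        LinearMap.ker ((LinearMap.proj a).comp O.mulVecLin : (κ → ℝ) →ₗ[ℝ] ℝ) := by
        rw [h]; trivial
      simpa using this)
  exact this

/-- The extremal case of the Brascamp–Lieb inequality for exponential weights: central sections
of the positive orthant by a subspace. -/
theorem setLIntegral_exp_neg_sum_mulVec_le_one (O : Matrix ι κ ℝ) (hO : O.transpose * O = 1) :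
    ∫⁻ y in {y : κ → ℝ | ∀ a, 0 ≤ (O.mulVec y) a},
      ENNReal.ofReal (Real.exp (-∑ a, (O.mulVec y) a)) ≤ 1 := by
  classical
  obtain ⟨T, hTmono, hTder⟩ := exists_strictMonoOn_hasDerivAt_exp
  set c : ι → ℝ := fun a => ∑ l, O a l ^ 2 with hc
  have hc0 : ∀ a, 0 ≤ c a := fun a => Finset.sum_nonneg fun _ _ => sq_nonneg _
  have hc1 : ∀ a, c a ≤ 1 := sum_sq_row_le_one O hO
  have hrow : ∀ a, c a = 0 → ∀ y, (O.mulVec y) a = 0 := by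
    intro a ha y
    refine Finset.sum_eq_zero fun l hl => ?_
    have := (Finset.sum_eq_zero_iff_of_nonneg fun _ _ => sq_nonneg _).1 ha l hl
    rw [pow_eq_zero_iff two_ne_zero] at this
    change O a l * y l = 0
    rw [this, zero_mul]
  set s : Set (κ → ℝ) := {y | ∀ a, c a ≠ 0 → 0 < (O.mulVec y) a} with hs
  have hsm : MeasurableSet s := by
    rw [hs, Set.ofPred_forall]
    refine MeasurableSet.iInter fun a => ?_
    rw [Set.ofPred_forall]
    refine MeasurableSet.iInter fun _ => measurableSet_lt measurable_const ?_
    exact Continuous.measurable (by fun_prop)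
  have hae : {y : κ → ℝ | ∀ a, 0 ≤ (O.mulVec y) a} =ᵐ[volume] s := by
    have hnull : ∀ᵐ y : κ → ℝ, ∀ a, c a ≠ 0 → (O.mulVec y) a ≠ 0 := by
      rw [ae_all_iff]
      intro a
      by_cases ha : c a = 0
      · exact Filter.Eventually.of_forall fun _ h => absurd ha h
      · have := volume_mulVec_apply_eq_zero O a ha
        filter_upwards [measure_eq_zero_iff_ae_notMem.1 this] with y hy _
        exact hy
    filter_upwards [hnull] with y hy
    refine propext ⟨fun h a ha => lt_of_le_of_ne (h a) (hy a ha).symm, fun h a => ?_⟩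
    by_cases ha : c a = 0
    · exact (hrow a ha y).ge
    · exact (h a ha).le
  rw [setLIntegral_congr hae]
  set t : ι → ℝ → ℝ := fun a x => √(c a) * T (x / c a) with ht
  set t' : ι → ℝ → ℝ := fun a x =>
    (√(c a))⁻¹ * Real.exp (Real.pi * T (x / c a) ^ 2 - x / c a) with ht'
  have ht'0 : ∀ a x, 0 ≤ t' a x := fun a x => by positivity
  have hder : ∀ a x, (c a ≠ 0 → 0 < x) → HasDerivAt (t a) (t' a x) x := by
    intro a x hx
    by_cases ha : c a = 0
    · simp only [ht, ht', ha, Real.sqrt_zero, zero_mul, inv_zero]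
      exact hasDerivAt_const x 0
    · have hca : 0 < c a := lt_of_le_of_ne (hc0 a) (Ne.symm ha)
      have h := ((hTder (x / c a) (div_pos (hx ha) hca)).comp x
        ((hasDerivAt_id x).div_const (c a))).const_mul (√(c a))
      refine h.congr_deriv ?_
      simp only [ht']
      have := Real.sq_sqrt hca.le
      have h0 := (Real.sqrt_pos.2 hca).ne'
      field_simp
      rw [this]
  have hmono : ∀ a x x', (c a ≠ 0 → 0 < x) → (c a ≠ 0 → 0 < x') →
      0 ≤ (t a x - t a x') * (x - x') ∧
        ((t a x - t a x') * (x - x') = 0 → c a ≠ 0 → x = x') := by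
    have key : ∀ a x x', c a ≠ 0 → 0 < x → 0 < x' → x < x' → t a x < t a x' := by
      intro a x x' ha h h' hlt
      have hca : 0 < c a := lt_of_le_of_ne (hc0 a) (Ne.symm ha)
      exact mul_lt_mul_of_pos_left (hTmono (div_pos h hca) (div_pos h' hca)
        (div_lt_div_of_pos_right hlt hca)) (Real.sqrt_pos.2 hca)
    intro a x x' hx hx'
    by_cases ha : c a = 0
    · simp [ht, ha]
    · rcases lt_trichotomy x x' with h | h | h
      · have := mul_pos_of_neg_of_neg (sub_neg.2 (key a x x' ha (hx ha) (hx' ha) h))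
          (sub_neg.2 h)
        exact ⟨this.le, fun h => absurd h this.ne'⟩
      · subst h; simp
      · have := mul_pos (sub_pos.2 (key a x' x ha (hx' ha) (hx ha) h)) (sub_pos.2 h)
        exact ⟨this.le, fun h => absurd h this.ne'⟩
  set f : (κ → ℝ) → κ → ℝ := fun y => O.transpose.mulVec fun a => t a ((O.mulVec y) a) with hf
  set f' : (κ → ℝ) → (κ → ℝ) →L[ℝ] (κ → ℝ) := fun y =>
    (Matrix.toLin' (O.transpose * Matrix.diagonal (fun a => t' a ((O.mulVec y) a)) *
      O)).toContinuousLinearMap with hf'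
  have hfder : ∀ y ∈ s, HasFDerivWithinAt f (f' y) s y := by
    intro y hy
    have h1 : HasFDerivAt (fun y => O.mulVec y) O.mulVecLin.toContinuousLinearMap y :=
      O.mulVecLin.toContinuousLinearMap.hasFDerivAt
    have h2 : HasFDerivAt (fun (u : ι → ℝ) a => t a (u a))
        (ContinuousLinearMap.pi fun a => (t' a ((O.mulVec y) a)) •
          (ContinuousLinearMap.proj a : (ι → ℝ) →L[ℝ] ℝ)) (O.mulVec y) := by
      refine hasFDerivAt_pi.2 fun a => ?_
      exact HasDerivAt.comp_hasFDerivAt (h₂ := t a) (f := fun u : ι → ℝ => u a) (O.mulVec y)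
        (hder a _ fun ha => hy a ha) (ContinuousLinearMap.proj a : (ι → ℝ) →L[ℝ] ℝ).hasFDerivAt
    have h3 := (O.transpose.mulVecLin.toContinuousLinearMap.hasFDerivAt (x := fun a =>
      t a ((O.mulVec y) a))).comp y (h2.comp y h1)
    refine (h3.congr_fderiv ?_).hasFDerivWithinAt
    refine ContinuousLinearMap.ext fun v => ?_
    simp only [hf', ContinuousLinearMap.comp_apply, LinearMap.coe_toContinuousLinearMap',
      Matrix.toLin'_apply, Matrix.mulVecLin_apply]
    rw [← Matrix.mulVec_mulVec, ← Matrix.mulVec_mulVec]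
    congr 1
    funext a
    simp [Matrix.mulVec_diagonal]
  have hinj : InjOn f s := by
    intro y hy y' hy' hyy
    have h0 : ∑ a, (t a ((O.mulVec y) a) - t a ((O.mulVec y') a)) *
        ((O.mulVec y) a - (O.mulVec y') a) = 0 := by
      have : (f y - f y') ⬝ᵥ (y - y') = 0 := by rw [hyy, sub_self, zero_dotProduct]
      rw [hf] at this
      simp only at this
      rw [← Matrix.mulVec_sub, Matrix.mulVec_transpose, ← Matrix.dotProduct_mulVec,
        Matrix.mulVec_sub] at this
      exact this
    have h1 := (Finset.sum_eq_zero_iff_of_nonneg fun a _ =>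
      (hmono a _ _ (hy a) (hy' a)).1).1 h0
    have h2 : O.mulVec y = O.mulVec y' := by
      funext a
      by_cases ha : c a = 0
      · rw [hrow a ha, hrow a ha]
      · exact (hmono a _ _ (hy a) (hy' a)).2 (h1 a (Finset.mem_univ a)) ha
    have h3 := congrArg O.transpose.mulVec h2
    rwa [Matrix.mulVec_mulVec, Matrix.mulVec_mulVec, hO, Matrix.one_mulVec,
      Matrix.one_mulVec] at h3
  have hpt : ∀ y ∈ s, ENNReal.ofReal (Real.exp (-∑ a, (O.mulVec y) a)) ≤
      ENNReal.ofReal |(f' y).det| * gaussWeight (f y) := by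
    intro y hy
    have hb : ∀ a, Real.exp (-(O.mulVec y) a) ≤ t' a ((O.mulVec y) a) ^ c a *
        Real.exp (-Real.pi * t a ((O.mulVec y) a) ^ 2) := by
      intro a
      by_cases ha : c a = 0
      · rw [hrow a ha, ha, Real.rpow_zero]
        simp [ht, ha]
      · have hca : 0 < c a := lt_of_le_of_ne (hc0 a) (Ne.symm ha)
        simp only [ht, ht']
        rw [Real.mul_rpow (by positivity) (Real.exp_pos _).le, ← Real.exp_mul, mul_assoc,
          ← Real.exp_add, mul_pow, Real.sq_sqrt hca.le]
        have h1 : 1 ≤ ((√(c a))⁻¹) ^ c a :=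
          Real.one_le_rpow ((one_le_inv₀ (Real.sqrt_pos.2 hca)).2
            (Real.sqrt_le_one.2 (hc1 a))) hca.le
        refine le_trans (le_of_eq ?_) (le_mul_of_one_le_left (Real.exp_pos _).le h1)
        congr 1
        field_simp
        ring
    have hdet : ∏ a, t' a ((O.mulVec y) a) ^ c a ≤ |(f' y).det| := by
      refine (prod_rpow_le_det_transpose_mul_diagonal_mul O hO _ fun a => ht'0 a _).trans
        ((le_of_eq ?_).trans (le_abs_self _))
      simp only [hf', LinearMap.det_toContinuousLinearMap, LinearMap.det_toLin']
    have hn := sum_sq_transpose_mulVec_le O hO fun a => t a ((O.mulVec y) a)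
    rw [gaussWeight, ← ENNReal.ofReal_mul (abs_nonneg _)]
    refine ENNReal.ofReal_le_ofReal ?_
    calc Real.exp (-∑ a, (O.mulVec y) a) = ∏ a, Real.exp (-(O.mulVec y) a) := by
          rw [← Real.exp_sum, Finset.sum_neg_distrib]
      _ ≤ ∏ a, (t' a ((O.mulVec y) a) ^ c a *
          Real.exp (-Real.pi * t a ((O.mulVec y) a) ^ 2)) :=
        Finset.prod_le_prod (fun _ _ => (Real.exp_pos _).le) fun a _ => hb a
      _ = (∏ a, t' a ((O.mulVec y) a) ^ c a) *
          Real.exp (-Real.pi * ∑ a, t a ((O.mulVec y) a) ^ 2) := by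
        rw [Finset.prod_mul_distrib, ← Real.exp_sum, Finset.mul_sum]
      _ ≤ |(f' y).det| * Real.exp (-Real.pi * ∑ l, f y l ^ 2) := by
        refine mul_le_mul hdet (Real.exp_le_exp.2 ?_) (Real.exp_pos _).le (abs_nonneg _)
        rw [neg_mul, neg_mul, neg_le_neg_iff]
        exact mul_le_mul_of_nonneg_left hn Real.pi_pos.le
  calc _ ≤ ∫⁻ y in s, ENNReal.ofReal |(f' y).det| * gaussWeight (f y) :=
        setLIntegral_mono' hsm hpt
    _ = ∫⁻ p in f '' s, gaussWeight p :=
        (lintegral_image_eq_lintegral_abs_det_fderiv_mul volume hsm hfder hinj _).symm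
    _ ≤ ∫⁻ p, gaussWeight p := setLIntegral_le_lintegral _ _
    _ = 1 := lintegral_gaussWeight

end

theorem lintegral_Ioi_exp_neg_mul_pow (k : ℕ) :
    ∫⁻ h in Ioi (0 : ℝ), ENNReal.ofReal (Real.exp (-h) * h ^ k) = k.factorial := by
  have h1 := Real.GammaIntegral_convergent (s := k + 1) (by positivity)
  have h2 := Real.Gamma_eq_integral (s := k + 1) (by positivity)
  rw [Real.Gamma_nat_eq_factorial] at h2
  rw [add_sub_cancel_right] at h1 h2
  simp only [Real.rpow_natCast] at h1 h2
  rw [← ofReal_integral_eq_lintegral_ofReal h1, ← h2, ENNReal.ofReal_natCast]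
  filter_upwards [self_mem_ae_restrict measurableSet_Ioi] with x hx
  have : 0 < x := hx
  positivity

theorem lintegral_cone_eq_factorial_mul_volume {k : ℕ} {X : Set (Fin k → ℝ)}
    (hX : MeasurableSet X) :
    ∫⁻ z in {z : Fin (k + 1) → ℝ | 0 < z 0 ∧ (z 0)⁻¹ • Fin.tail z ∈ X},
      ENNReal.ofReal (Real.exp (-z 0)) = k.factorial * volume X := by
  set s : Set (Fin (k + 1) → ℝ) := {z | 0 < z 0 ∧ (z 0)⁻¹ • Fin.tail z ∈ X} with hs
  have hmap : Measurable fun z : Fin (k + 1) → ℝ => (z 0)⁻¹ • Fin.tail z := by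
    unfold Fin.tail
    refine measurable_pi_lambda _ fun i => ?_
    exact ((measurable_pi_apply 0).inv).mul (measurable_pi_apply _)
  have hsm : MeasurableSet s :=
    (measurableSet_lt measurable_const (measurable_pi_apply 0)).inter (hmap hX)
  have hF : Measurable (s.indicator fun z : Fin (k + 1) → ℝ =>
      ENNReal.ofReal (Real.exp (-z 0))) := by
    refine Measurable.indicator ?_ hsm
    fun_prop
  rw [← lintegral_indicator hsm]
  have hmp := (volume_preserving_piFinSuccAbove (fun _ : Fin (k + 1) => ℝ) 0).symm
  have hF2 : Measurable fun p : ℝ × (Fin k → ℝ) => s.indicator (fun z : Fin (k + 1) → ℝ =>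
      ENNReal.ofReal (Real.exp (-z 0)))
        ((MeasurableEquiv.piFinSuccAbove (fun _ : Fin (k + 1) => ℝ) 0).symm p) :=
    hF.comp hmp.measurable
  rw [← hmp.lintegral_comp hF, Measure.volume_eq_prod, lintegral_prod _ hF2.aemeasurable]
  have hcons : ∀ (h : ℝ) (y : Fin k → ℝ),
      (MeasurableEquiv.piFinSuccAbove (fun _ : Fin (k + 1) => ℝ) 0).symm (h, y) =
        Fin.cons h y := fun h y => Fin.insertNth_zero (α := fun _ => ℝ) h y
  simp_rw [hcons]
  have inner : ∀ h : ℝ, ∫⁻ y : Fin k → ℝ, s.indicator (fun z : Fin (k + 1) → ℝ =>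
      ENNReal.ofReal (Real.exp (-z 0)))
        (Fin.cons h y) =
      (Ioi 0).indicator (fun h => ENNReal.ofReal (Real.exp (-h) * h ^ k)) h * volume X := by
    intro h
    by_cases hh : 0 < h
    · rw [indicator_of_mem (show h ∈ Ioi 0 from hh)]
      have hpre : MeasurableSet ((fun y : Fin k → ℝ => h⁻¹ • y) ⁻¹' X) :=
        (measurable_const_smul _) hX
      have e : ∀ y : Fin k → ℝ, s.indicator (fun z : Fin (k + 1) → ℝ =>
          ENNReal.ofReal (Real.exp (-z 0)))
          (Fin.cons h y) =
          ((fun y : Fin k → ℝ => h⁻¹ • y) ⁻¹' X).indicator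
            (fun _ => ENNReal.ofReal (Real.exp (-h))) y := by
        intro y
        have hiff : (Fin.cons h y : Fin (k + 1) → ℝ) ∈ s ↔
            y ∈ (fun y : Fin k → ℝ => h⁻¹ • y) ⁻¹' X := by
          rw [hs, mem_ofPred_eq, Fin.cons_zero, Fin.tail_cons]
          exact and_iff_right hh
        by_cases hy : y ∈ (fun y : Fin k → ℝ => h⁻¹ • y) ⁻¹' X
        · rw [indicator_of_mem (hiff.2 hy), indicator_of_mem hy, Fin.cons_zero]
        · rw [indicator_of_notMem (mt hiff.1 hy), indicator_of_notMem hy]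
      simp_rw [e]
      rw [lintegral_indicator hpre, setLIntegral_const,
        Measure.addHaar_preimage_smul _ (inv_ne_zero hh.ne'),
        ENNReal.ofReal_mul (Real.exp_pos _).le, mul_assoc]
      congr 3
      simp [abs_of_pos hh]
    · rw [indicator_of_notMem (show h ∉ Ioi 0 from hh), zero_mul]
      rw [← lintegral_zero (α := Fin k → ℝ) (μ := volume)]
      refine lintegral_congr fun y => indicator_of_notMem ?_ _
      simp [hs, hh]
  simp_rw [inner]
  rw [lintegral_mul_const _ (Measurable.indicator (by fun_prop) measurableSet_Ioi),
    lintegral_indicator measurableSet_Ioi, lintegral_Ioi_exp_neg_mul_pow]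

theorem coneMatrix_mulVec_apply {n k : ℕ} (v : Fin (n + 1) → Fin n → ℝ) (β : Fin (n + 1) → ℝ)
    (A : Matrix (Fin n) (Fin k) ℝ) (b : Fin n → ℝ) (z : Fin (k + 1) → ℝ) (j : Fin (n + 1)) :
    ((coneMatrix v β A b).mulVec z) j =
      β j * (z 0 + ∑ i, ((A.mulVec (Fin.tail z)) i + z 0 * b i) * v j i) := by
  have h1 : ∑ i, (A.mulVec (Fin.tail z)) i * v j i =
      ∑ l, (∑ i, v j i * A i l) * z l.succ := by
    simp only [Matrix.mulVec, dotProduct, Finset.sum_mul, Fin.tail]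
    rw [Finset.sum_comm]
    exact Finset.sum_congr rfl fun _ _ => Finset.sum_congr rfl fun _ _ => by ring
  have h2 : ∑ i, z 0 * b i * v j i = z 0 * ∑ i, b i * v j i := by
    simp only [Finset.mul_sum, mul_assoc]
  simp only [add_mul, Finset.sum_add_distrib, h1, h2]
  simp only [coneMatrix, Matrix.mulVec, dotProduct, Matrix.of_apply, Fin.sum_univ_succ,
    Fin.cons_zero, Fin.cons_succ, mul_assoc, ← Finset.mul_sum]
  ring

theorem sum_coneMatrix_mulVec {n k : ℕ} (v : Fin (n + 1) → Fin n → ℝ) (β : Fin (n + 1) → ℝ)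
    (hβ1 : ∑ j, β j = 1) (hβv : ∀ i, ∑ j, β j * v j i = 0)
    (A : Matrix (Fin n) (Fin k) ℝ) (b : Fin n → ℝ) (z : Fin (k + 1) → ℝ) :
    ∑ j, ((coneMatrix v β A b).mulVec z) j = z 0 := by
  simp only [coneMatrix_mulVec_apply, mul_add, Finset.sum_add_distrib, ← Finset.sum_mul, hβ1,
    one_mul, Finset.mul_sum]
  rw [Finset.sum_comm]
  simp only [mul_left_comm (β _), ← Finset.mul_sum, hβv, mul_zero, Finset.sum_const_zero, add_zero]

theorem setLIntegral_coneMatrix {n k : ℕ} (v : Fin (n + 1) → Fin n → ℝ) (β : Fin (n + 1) → ℝ)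
    (hβ : ∀ j, 0 < β j) (hβ1 : ∑ j, β j = 1) (hβv : ∀ i, ∑ j, β j * v j i = 0)
    (A : Matrix (Fin n) (Fin k) ℝ) (b : Fin n → ℝ) :
    ∫⁻ z in {z | ∀ j, 0 ≤ ((coneMatrix v β A b).mulVec z) j},
      ENNReal.ofReal (Real.exp (-∑ j, ((coneMatrix v β A b).mulVec z) j)) =
    k.factorial * volume {y : Fin k → ℝ | ∀ j, -1 ≤ ∑ i, (A.mulVec y + b) i * v j i} := by
  have hXm : MeasurableSet {y : Fin k → ℝ | ∀ j, -1 ≤ ∑ i, (A.mulVec y + b) i * v j i} := by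
    rw [Set.ofPred_forall]
    refine MeasurableSet.iInter fun j => measurableSet_le measurable_const ?_
    exact Continuous.measurable (by fun_prop)
  rw [← lintegral_cone_eq_factorial_mul_volume hXm]
  simp only [sum_coneMatrix_mulVec v β hβ1 hβv]
  refine setLIntegral_congr ?_
  have hnull : ∀ᵐ z : Fin (k + 1) → ℝ, z 0 ≠ 0 := by
    have := volume_mulVec_apply_eq_zero (1 : Matrix (Fin (k + 1)) (Fin (k + 1)) ℝ) 0
      (by simp [Matrix.one_apply])
    simp only [Matrix.one_mulVec] at this
    exact measure_eq_zero_iff_ae_notMem.1 this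
  filter_upwards [hnull] with z hz
  refine propext ?_
  have key : 0 < z 0 → ∀ j, (0 ≤ ((coneMatrix v β A b).mulVec z) j ↔
      -1 ≤ ∑ i, (A.mulVec ((z 0)⁻¹ • Fin.tail z) + b) i * v j i) := by
    intro h0 j
    rw [coneMatrix_mulVec_apply, mul_nonneg_iff_of_pos_left (hβ j)]
    have : z 0 + ∑ i, ((A.mulVec (Fin.tail z)) i + z 0 * b i) * v j i =
        z 0 * (1 + ∑ i, (A.mulVec ((z 0)⁻¹ • Fin.tail z) + b) i * v j i) := by
      rw [mul_add, mul_one, Finset.mul_sum]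
      congr 1
      refine Finset.sum_congr rfl fun i _ => ?_
      rw [Matrix.mulVec_smul, Pi.add_apply, Pi.smul_apply, smul_eq_mul, ← mul_assoc, mul_add,
        mul_inv_cancel_left₀ h0.ne']
    rw [this, mul_nonneg_iff_of_pos_left h0]
    constructor <;> intro h <;> linarith
  constructor
  · intro h
    have h0 : 0 < z 0 := by
      refine lt_of_le_of_ne ?_ hz.symm
      rw [← sum_coneMatrix_mulVec v β hβ1 hβv A b z]
      exact Finset.sum_nonneg fun j _ => h j
    exact ⟨h0, fun j => (key h0 j).1 (h j)⟩
  · rintro ⟨h0, h⟩ j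
    exact (key h0 j).2 (h j)

theorem lintegral_comp_mulVec {κ : Type*} [Fintype κ] [DecidableEq κ] (R : Matrix κ κ ℝ)
    (hR : R.det ≠ 0) {F : (κ → ℝ) → ℝ≥0∞} (hF : Measurable F) :
    ∫⁻ y, F y = ENNReal.ofReal |R.det| * ∫⁻ y, F (R.mulVec y) := by
  have h := Real.map_matrix_volume_pi_eq_smul_volume_pi hR
  have h2 : ∫⁻ y, F (R.mulVec y) = ENNReal.ofReal |R.det⁻¹| * ∫⁻ y, F y := by
    rw [← smul_eq_mul, ← lintegral_smul_measure, ← h,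
      lintegral_map hF (Continuous.measurable (LinearMap.continuous_of_finiteDimensional _))]
    rfl
  rw [h2, ← mul_assoc, ← ENNReal.ofReal_mul (abs_nonneg _), ← abs_mul, mul_inv_cancel₀ hR,
    abs_one, ENNReal.ofReal_one, one_mul]

theorem setLIntegral_exp_neg_sum_comp_mulVec {ι κ : Type*} [Fintype ι] [Fintype κ] [DecidableEq κ]
    (G : Matrix ι κ ℝ) (R : Matrix κ κ ℝ) (hR : R.det ≠ 0) :
    ∫⁻ z in {z | ∀ j, 0 ≤ (G.mulVec z) j}, ENNReal.ofReal (Real.exp (-∑ j, (G.mulVec z) j)) =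
      ENNReal.ofReal |R.det| * ∫⁻ z in {z | ∀ j, 0 ≤ ((G * R).mulVec z) j},
        ENNReal.ofReal (Real.exp (-∑ j, ((G * R).mulVec z) j)) := by
  have hm : ∀ G : Matrix ι κ ℝ, MeasurableSet {z | ∀ j, 0 ≤ (G.mulVec z) j} := by
    intro G
    rw [Set.ofPred_forall]
    refine MeasurableSet.iInter fun j => measurableSet_le measurable_const ?_
    exact Continuous.measurable (by fun_prop)
  rw [← lintegral_indicator (hm _), ← lintegral_indicator (hm _), lintegral_comp_mulVec R hR]
  · congr 1
    refine lintegral_congr fun y => ?_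
    simp only [indicator, mem_ofPred_eq, Matrix.mulVec_mulVec]
  · exact Measurable.indicator (by fun_prop) (hm _)

theorem setLIntegral_exp_neg_sum_eq_one {κ : Type*} [Fintype κ] :
    ∫⁻ z in {z : κ → ℝ | ∀ j, 0 ≤ z j}, ENNReal.ofReal (Real.exp (-∑ j, z j)) = 1 := by
  have hm : MeasurableSet {z : κ → ℝ | ∀ j, 0 ≤ z j} := by
    rw [Set.ofPred_forall]
    exact MeasurableSet.iInter fun j => measurableSet_le measurable_const (measurable_pi_apply j)
  have h1 : Integrable ((Ioi (0 : ℝ)).indicator fun x => Real.exp (-x)) := by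
    rw [integrable_indicator_iff measurableSet_Ioi]
    simpa using integrableOn_exp_mul_Ioi (a := -1) (by norm_num) 0
  have h2 := Integrable.fintype_prod (ι := κ) (μ := fun _ => volume) fun _ => h1
  have h3 := ofReal_integral_eq_lintegral_ofReal h2 (Filter.Eventually.of_forall fun _ =>
    Finset.prod_nonneg fun _ _ => indicator_nonneg (fun _ _ => (Real.exp_pos _).le) _)
  rw [integral_fintype_prod_eq_prod, integral_indicator measurableSet_Ioi,
    integral_exp_neg_Ioi_zero, Finset.prod_const_one, ENNReal.ofReal_one] at h3
  rw [h3, ← volume_pi, ← lintegral_indicator hm]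
  have hae : ∀ᵐ z : κ → ℝ, ∀ j, z j ≠ 0 := by
    classical
    rw [ae_all_iff]
    intro j
    have := volume_mulVec_apply_eq_zero (1 : Matrix κ κ ℝ) j (by simp [Matrix.one_apply])
    simp only [Matrix.one_mulVec] at this
    exact measure_eq_zero_iff_ae_notMem.1 this
  refine lintegral_congr_ae ?_
  filter_upwards [hae] with z hz
  by_cases h : z ∈ {z : κ → ℝ | ∀ j, 0 ≤ z j}
  · rw [indicator_of_mem h, Finset.prod_congr rfl fun j _ =>
      indicator_of_mem (show z j ∈ Ioi 0 from lt_of_le_of_ne (h j) (hz j).symm) _,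
      ← Real.exp_sum, Finset.sum_neg_distrib]
  · rw [indicator_of_notMem h]
    rw [mem_ofPred_eq] at h
    push Not at h
    obtain ⟨j, hj⟩ := h
    have h0 : (Ioi (0 : ℝ)).indicator (fun x => Real.exp (-x)) (z j) = 0 :=
      indicator_of_notMem (by simpa using hj.le) _
    rw [Finset.prod_eq_zero (Finset.mem_univ j) h0, ENNReal.ofReal_zero]

theorem Matrix.exists_transpose_mul_self_eq_one {ι κ : Type*} [Fintype ι] [Fintype κ]
    [DecidableEq κ] (G : Matrix ι κ ℝ) (hG : ∀ z, G.mulVec z = 0 → z = 0) :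
    ∃ R : Matrix κ κ ℝ, (G * R).transpose * (G * R) = 1 := by
  have hMh : (G.transpose * G).IsHermitian := by
    rw [Matrix.IsHermitian, Matrix.conjTranspose_eq_transpose_of_trivial, Matrix.transpose_mul,
      Matrix.transpose_transpose]
  obtain ⟨V, lam, hV, hdiag⟩ : ∃ (V : Matrix κ κ ℝ) (lam : κ → ℝ), V.transpose * V = 1 ∧
      (G * V).transpose * (G * V) = Matrix.diagonal lam := by
    refine ⟨hMh.eigenvectorUnitary, hMh.eigenvalues, ?_, ?_⟩
    · have := Unitary.coe_star_mul_self hMh.eigenvectorUnitary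
      rwa [Matrix.star_eq_conjTranspose, Matrix.conjTranspose_eq_transpose_of_trivial] at this
    · have h := hMh.conjStarAlgAut_star_eigenvectorUnitary
      rw [Unitary.conjStarAlgAut_star_apply, Matrix.star_eq_conjTranspose,
        Matrix.conjTranspose_eq_transpose_of_trivial] at h
      rw [Matrix.transpose_mul]
      simp only [Matrix.mul_assoc] at h ⊢
      exact h
  have hlam : ∀ l, 0 < lam l := by
    intro l
    have h1 : lam l = ∑ a, (G * V) a l ^ 2 := by
      have := congrFun (congrFun hdiag l) l
      rw [Matrix.diagonal_apply_eq, Matrix.mul_apply] at this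
      rw [← this]
      refine Finset.sum_congr rfl fun a _ => ?_
      rw [Matrix.transpose_apply, sq]
    refine lt_of_le_of_ne (h1 ▸ Finset.sum_nonneg fun _ _ => sq_nonneg _) fun h0 => ?_
    rw [h1] at h0
    have h2 : (G * V).mulVec (Pi.single l 1) = 0 := by
      funext a
      have := (Finset.sum_eq_zero_iff_of_nonneg fun _ _ => sq_nonneg _).1 h0.symm a
        (Finset.mem_univ a)
      rw [pow_eq_zero_iff two_ne_zero] at this
      simpa using this
    rw [← Matrix.mulVec_mulVec] at h2
    have h3 := congrArg V.transpose.mulVec (hG _ h2)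
    rw [Matrix.mulVec_mulVec, hV, Matrix.one_mulVec, Matrix.mulVec_zero] at h3
    have := congrFun h3 l
    simp at this
  refine ⟨V * Matrix.diagonal fun l => (√(lam l))⁻¹, ?_⟩
  have key : ∀ W : Matrix κ κ ℝ, (G * (V * W)).transpose * (G * (V * W)) =
      W.transpose * ((G * V).transpose * (G * V)) * W := by
    intro W
    simp only [Matrix.transpose_mul, Matrix.mul_assoc]
  rw [key, hdiag, Matrix.diagonal_transpose, Matrix.diagonal_mul_diagonal,
    Matrix.diagonal_mul_diagonal, ← Matrix.diagonal_one]
  congr 1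
  funext l
  have h1 := Real.sq_sqrt (hlam l).le
  have h2 := (Real.sqrt_pos.2 (hlam l)).ne'
  field_simp
  exact h1.symm

theorem coneMatrix_mulVec_injective {n k : ℕ} (v : Fin (n + 1) → Fin n → ℝ)
    (β : Fin (n + 1) → ℝ) (hβ : ∀ j, 0 < β j) (hβ1 : ∑ j, β j = 1)
    (hβv : ∀ i, ∑ j, β j * v j i = 0)
    (hv : ∀ u : Fin n → ℝ, (∀ j, ∑ i, u i * v j i = 0) → u = 0)
    (A : Matrix (Fin n) (Fin k) ℝ) (hA : ∀ y, A.mulVec y = 0 → y = 0) (b : Fin n → ℝ)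
    (z : Fin (k + 1) → ℝ) (hz : (coneMatrix v β A b).mulVec z = 0) : z = 0 := by
  have h0 : z 0 = 0 := by
    rw [← sum_coneMatrix_mulVec v β hβ1 hβv A b z, hz]
    simp
  have h1 : Fin.tail z = 0 := by
    refine hA _ (hv _ fun j => ?_)
    have := congrFun hz j
    rw [coneMatrix_mulVec_apply, h0] at this
    simpa [(hβ j).ne'] using this
  rw [← Fin.cons_self_tail z, h0, h1]
  funext i
  refine Fin.cases ?_ (fun _ => ?_) i <;> simp

/-- Sections of the polar of a simplex by integral affine subspaces. -/
theorem factorial_mul_volume_section_le {n k : ℕ} (v : Fin (n + 1) → Fin n → ℝ)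
    (β : Fin (n + 1) → ℝ) (hβ : ∀ j, 0 < β j) (hβ1 : ∑ j, β j = 1)
    (hβv : ∀ i, ∑ j, β j * v j i = 0)
    (hv : ∀ u : Fin n → ℝ, (∀ j, ∑ i, u i * v j i = 0) → u = 0)
    (hlat : ∀ (z : Fin n → ℤ) (δ : Fin (n + 1) → ℝ), (∀ j, |δ j| < 1) →
      (∀ i, (z i : ℝ) = ∑ j, β j * v j i * δ j) → z = 0)
    (A : Matrix (Fin n) (Fin k) ℤ)
    (hA : ∀ y, (A.map (Int.cast : ℤ → ℝ)).mulVec y = 0 → y = 0) (b : Fin n → ℝ) :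
    k.factorial * volume {y : Fin k → ℝ | ∀ j,
        -1 ≤ ∑ i, ((A.map (Int.cast : ℤ → ℝ)).mulVec y + b) i * v j i} ≤
      n.factorial * volume {x : Fin n → ℝ | ∀ j, -1 ≤ ∑ i, x i * v j i} := by
  have hA1 : ∀ y : Fin n → ℝ, (1 : Matrix (Fin n) (Fin n) ℝ).mulVec y = 0 → y = 0 := fun y hy => by
    rwa [Matrix.one_mulVec] at hy
  set H : Matrix (Fin (n + 1)) (Fin (n + 1)) ℝ := coneMatrix (k := n) v β 1 0 with hH
  set G := coneMatrix v β (A.map (Int.cast : ℤ → ℝ)) b with hG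
  have hHdet : H.det ≠ 0 := by
    intro h
    obtain ⟨z, hz, hz0⟩ := Matrix.exists_mulVec_eq_zero_iff.2 h
    exact hz (coneMatrix_mulVec_injective v β hβ hβ1 hβv hv 1 hA1 0 z hz0)
  obtain ⟨R, hR⟩ := G.exists_transpose_mul_self_eq_one
    (coneMatrix_mulVec_injective v β hβ hβ1 hβv hv _ hA b)
  have hRdet : R.det ≠ 0 := by
    have := congrArg Matrix.det hR
    rw [← Matrix.mul_assoc, Matrix.det_mul, Matrix.det_one] at this
    exact right_ne_zero_of_mul_eq_one this
  have hvol : ENNReal.ofReal |H.det| * (n.factorial *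
      volume {x : Fin n → ℝ | ∀ j, -1 ≤ ∑ i, x i * v j i}) = 1 := by
    have h1 := setLIntegral_coneMatrix v β hβ hβ1 hβv (1 : Matrix (Fin n) (Fin n) ℝ) 0
    simp only [Matrix.one_mulVec, add_zero] at h1
    have h2 := setLIntegral_exp_neg_sum_comp_mulVec (1 : Matrix (Fin (n + 1)) (Fin (n + 1)) ℝ) H
      hHdet
    simp only [Matrix.one_mulVec, Matrix.one_mul] at h2
    rw [setLIntegral_exp_neg_sum_eq_one, h1] at h2
    exact h2.symm
  have hX := setLIntegral_coneMatrix v β hβ hβ1 hβv (A.map (Int.cast : ℤ → ℝ)) b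
  rw [← hG, setLIntegral_exp_neg_sum_comp_mulVec G R hRdet] at hX
  have hBC := mul_abs_det_le_one_of_volume_slab_le G R hR (abs_nonneg H.det) fun ε _ => by
    have := volume_slab_mul_det_le v β A b hA hlat ε
    rwa [Fintype.card_fin]
  have hle : (k.factorial : ℝ≥0∞) * volume {y : Fin k → ℝ | ∀ j,
      -1 ≤ ∑ i, ((A.map (Int.cast : ℤ → ℝ)).mulVec y + b) i * v j i} ≤
      ENNReal.ofReal |R.det| := by
    rw [← hX]
    exact mul_le_of_le_one_right' (setLIntegral_exp_neg_sum_mulVec_le_one (G * R) hR)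
  refine hle.trans ?_
  have hc0 : ENNReal.ofReal |H.det| ≠ 0 := by simpa using hHdet
  refine (ENNReal.mul_le_mul_iff_right hc0 ENNReal.ofReal_ne_top).1 ?_
  rw [hvol, ← ENNReal.ofReal_mul (abs_nonneg _)]
  exact ENNReal.ofReal_le_one.2 hBC

theorem measurableSet_polarDual_range {n : ℕ} {ι : Type*} [Finite ι] (v : ι → Fin n → ℝ) :
    MeasurableSet {x : Fin n → ℝ | ∀ j, -1 ≤ ∑ i, x i * v j i} := by
  rw [Set.ofPred_forall]
  exact MeasurableSet.iInter fun j => measurableSet_le measurable_const (by fun_prop)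

theorem polarDual_convexHull_range {n : ℕ} {ι : Type*} (v : ι → Fin n → ℝ) :
    polarDual (convexHull ℝ (range v)) = {x : Fin n → ℝ | ∀ j, -1 ≤ ∑ i, x i * v j i} := by
  ext y
  constructor
  · exact fun h j => h _ (subset_convexHull ℝ _ (mem_range_self j))
  · intro h x hx
    have hc : Convex ℝ {x : Fin n → ℝ | -1 ≤ ∑ i, y i * x i} := by
      have : IsLinearMap ℝ fun x : Fin n → ℝ => ∑ i, y i * x i :=
        ⟨fun a b => by simp [mul_add, Finset.sum_add_distrib],
          fun c a => by simp [Finset.mul_sum, mul_left_comm]⟩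
      exact convex_halfSpace_ge this (-1)
    exact convexHull_min (by rintro _ ⟨j, rfl⟩; exact h j) hc hx

/-- Sections of the polar of a canonical Fano simplex by integral affine subspaces. -/
theorem IsCanonicalFano.factorial_mul_volume_section_le {n k : ℕ} {S : Set (Fin n → ℝ)}
    (hS : IsCanonicalFano S) (hS' : IsSimplexOfDim n S) (A : Matrix (Fin n) (Fin k) ℤ)
    (hA : ∀ y, (A.map (Int.cast : ℤ → ℝ)).mulVec y = 0 → y = 0) (b : Fin n → ℝ) :
    k.factorial * volume {y : Fin k → ℝ |
        (A.map (Int.cast : ℤ → ℝ)).mulVec y + b ∈ polarDual S} ≤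
      n.factorial * volume (polarDual S) := by
  obtain ⟨v, hind, rfl⟩ := hS'
  have h0 : (0 : Fin n → ℝ) ∈ interior (convexHull ℝ (range v)) := by
    have : (0 : Fin n → ℝ) ∈ ({0} : Set (Fin n → ℝ)) := rfl
    rw [← hS.2] at this
    exact this.1
  let B : AffineBasis (Fin (n + 1)) ℝ (Fin n → ℝ) :=
    ⟨v, hind, hind.affineSpan_eq_top_iff_card_eq_finrank_add_one.2 (by simp)⟩
  have h_int : interior (convexHull ℝ (range v)) = {x | ∀ i, 0 < B.coord i x} :=
    B.interior_convexHull
  have hmem : ∀ w : Fin (n + 1) → ℝ, (∀ j, 0 < w j) → ∑ j, w j = 1 →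
      ∑ j, w j • v j ∈ interior (convexHull ℝ (range v)) := by
    intro w hw hw1
    rw [h_int]
    intro j
    have := B.coord_apply_combination_of_mem (Finset.mem_univ j) hw1
    rw [Finset.univ.affineCombination_eq_linear_combination _ _ hw1] at this
    change 0 < B.coord j (∑ j, w j • B j)
    rw [this]
    exact hw j
  have hcomb := B.linear_combination_coord_eq_self 0
  have hβv : ∀ i, ∑ j, B.coord j 0 * v j i = 0 := by
    intro i
    have := congrFun hcomb i
    rw [Finset.sum_apply] at this
    exact this
  have hβ : ∀ j, 0 < B.coord j 0 := by rw [h_int] at h0; exact h0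
  have hβ1 := B.sum_coord_apply_eq_one 0
  have hv : ∀ u : Fin n → ℝ, (∀ j, ∑ i, u i * v j i = 0) → u = 0 := by
    intro u hu
    have hlin : IsLinearMap ℝ fun x : Fin n → ℝ => ∑ i, u i * x i :=
      ⟨fun a b => by simp [mul_add, Finset.sum_add_distrib],
        fun c a => by simp [Finset.mul_sum, mul_left_comm]⟩
    have hzero : ∀ x ∈ convexHull ℝ (range v), ∑ i, u i * x i = 0 := by
      intro x hx
      exact convexHull_min (by rintro _ ⟨j, rfl⟩; exact hu j) (convex_hyperplane hlin 0) hx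
    have hcont : Filter.Tendsto (fun c : ℝ => c • u) (nhdsWithin 0 (Ioi 0)) (nhds 0) := by
      have : Continuous fun c : ℝ => c • u := by fun_prop
      simpa using (this.tendsto 0).mono_left nhdsWithin_le_nhds
    obtain ⟨c, hc, hc0⟩ := ((hcont.eventually (mem_interior_iff_mem_nhds.1 h0)).and
      self_mem_nhdsWithin).exists
    have h1 := hzero _ hc
    have hc0 : 0 < c := hc0
    have h2 : ∑ i, u i * u i = 0 := by
      simp only [Pi.smul_apply, smul_eq_mul, mul_left_comm _ c, ← Finset.mul_sum] at h1
      exact (mul_eq_zero.1 h1).resolve_left hc0.ne'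
    funext i
    exact mul_self_eq_zero.1 ((Finset.sum_eq_zero_iff_of_nonneg fun i _ =>
      mul_self_nonneg (u i)).1 h2 i (Finset.mem_univ i))
  have hzlat : ∀ (z : Fin n → ℤ) (δ : Fin (n + 1) → ℝ), (∀ j, -1 < δ j - ∑ l, B.coord l 0 * δ l) →
      (∀ i, (z i : ℝ) = ∑ j, B.coord j 0 * v j i * δ j) → z = 0 := by
    intro z δ hδ hz
    have h1 := hmem (fun j => B.coord j 0 * (δ j + 1 - ∑ l, B.coord l 0 * δ l))
      (fun j => mul_pos (hβ j) (by linarith [hδ j])) (by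
        simp only [mul_sub, mul_add, Finset.sum_sub_distrib, Finset.sum_add_distrib, mul_one, hβ1,
          ← Finset.sum_mul]
        ring)
    have h2 : ∑ j, (B.coord j 0 * (δ j + 1 - ∑ l, B.coord l 0 * δ l)) • v j =
        fun i => (z i : ℝ) := by
      funext i
      have : ∀ j, B.coord j 0 * (δ j + 1 - ∑ l, B.coord l 0 * δ l) * v j i =
          B.coord j 0 * v j i * δ j + (1 - ∑ l, B.coord l 0 * δ l) * (B.coord j 0 * v j i) :=
        fun j => by ring
      simp only [Finset.sum_apply, Pi.smul_apply, smul_eq_mul, this, Finset.sum_add_distrib,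
        ← Finset.mul_sum, hβv, mul_zero, add_zero]
      exact (hz i).symm
    rw [h2] at h1
    have h3 : (fun i => (z i : ℝ)) ∈ ({0} : Set (Fin n → ℝ)) := by
      rw [← hS.2]
      exact ⟨h1, fun i => ⟨z i, rfl⟩⟩
    funext i
    have := congrFun (mem_singleton_iff.1 h3) i
    simpa using this
  have hlat : ∀ (z : Fin n → ℤ) (δ : Fin (n + 1) → ℝ), (∀ j, |δ j| < 1) →
      (∀ i, (z i : ℝ) = ∑ j, B.coord j 0 * v j i * δ j) → z = 0 := by
    intro z δ hδ hz
    by_cases h1 : ∀ j, -1 < δ j - ∑ l, B.coord l 0 * δ l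
    · exact hzlat z δ h1 hz
    by_cases h2 : ∀ j, -1 < -δ j - ∑ l, B.coord l 0 * -δ l
    · have := hzlat (-z) (-δ) h2 fun i => by simp [hz i]
      exact neg_eq_zero.1 this
    exfalso
    push Not at h1 h2
    obtain ⟨j, hj⟩ := h1
    obtain ⟨l, hl⟩ := h2
    simp only [mul_neg, Finset.sum_neg_distrib] at hl
    have := abs_lt.1 (hδ j)
    have := abs_lt.1 (hδ l)
    linarith
  rw [polarDual_convexHull_range]
  exact _root_.factorial_mul_volume_section_le v _ hβ hβ1 hβv hv hlat A hA b

theorem measurableSet_polarDual_of_isSimplexOfDim {n k : ℕ} {S : Set (Fin n → ℝ)}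
    (hS : IsSimplexOfDim k S) : MeasurableSet (polarDual S) := by
  obtain ⟨v, -, rfl⟩ := hS
  rw [polarDual_convexHull_range]
  exact measurableSet_polarDual_range v

theorem Matrix.mulVec_map_intCast_eq_zero {m n : Type*} [Fintype m] [Fintype n] [DecidableEq m]
    [DecidableEq n] (A : Matrix m n ℤ) (hA : ∀ y, A.mulVec y = 0 → y = 0) (y : n → ℝ)
    (hy : (A.map (Int.cast : ℤ → ℝ)).mulVec y = 0) : y = 0 := by
  have hQ : ∀ y : n → ℚ, (A.map (Int.cast : ℤ → ℚ)).mulVec y = 0 → y = 0 := by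
    intro y hy
    obtain ⟨b, hb⟩ := IsLocalization.exist_integer_multiples_of_finite (nonZeroDivisors ℤ) y
    choose z hz using hb
    have hb0 : ((b : ℤ) : ℚ) ≠ 0 := by
      exact_mod_cast nonZeroDivisors.ne_zero b.2
    have hz' : ∀ j, (z j : ℚ) = (b : ℤ) * y j := fun j => by simpa using hz j
    have h0 : z = 0 := by
      apply hA
      funext i
      have h1 := congrFun hy i
      simp only [Matrix.mulVec, dotProduct, Matrix.map_apply, Pi.zero_apply] at h1 ⊢
      have : ((∑ j, A i j * z j : ℤ) : ℚ) = 0 := by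
        push_cast
        simp only [hz', mul_left_comm _ ((b : ℤ) : ℚ), ← Finset.mul_sum, h1, mul_zero]
      exact_mod_cast this
    funext j
    have := hz' j
    simp only [h0, Pi.zero_apply, Int.cast_zero] at this
    exact (mul_eq_zero.1 this.symm).resolve_left hb0
  obtain ⟨L, hL⟩ := Matrix.exists_left_inverse_of_mulVec_eq_zero _ hQ
  have hLR : L.map (Rat.cast : ℚ → ℝ) * A.map (Int.cast : ℤ → ℝ) = 1 := by
    have h1 := congrArg (fun M : Matrix n n ℚ => M.map (Rat.castHom ℝ)) hL
    simp only [Matrix.map_mul] at h1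
    rw [Matrix.map_one _ (map_zero _) (map_one _), Matrix.map_map] at h1
    rw [← h1]
    congr 1
  calc y = (L.map (Rat.cast : ℚ → ℝ) * A.map (Int.cast : ℤ → ℝ)).mulVec y := by
        rw [hLR, Matrix.one_mulVec]
    _ = 0 := by rw [← Matrix.mulVec_mulVec, hy, Matrix.mulVec_zero]

theorem Matrix.exists_unimodular_mul_splitting {m κ : Type*} [Fintype m] [Fintype κ]
    [DecidableEq m] [DecidableEq κ] (A : Matrix m κ ℤ) :
    ∃ (U : Matrix κ κ ℤ) (p : κ → Prop), IsUnit U.det ∧ (∀ j, p j → ∀ i, (A * U) i j = 0) ∧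
      ∀ y : κ → ℤ, (∀ j, p j → y j = 0) → (A * U).mulVec y = 0 → y = 0 := by
  obtain ⟨k, ⟨bM, bN, f, a, snf⟩⟩ :=
    Submodule.smithNormalForm (Pi.basisFun ℤ κ) (LinearMap.ker A.mulVecLin)
  have hAU : ∀ y : κ → ℤ, ((Matrix.of fun i j => bM j i : Matrix κ κ ℤ)).mulVec y =
      ∑ j, y j • bM j := by
    intro y
    funext i
    simp [Matrix.mulVec, dotProduct, mul_comm]
  refine ⟨Matrix.of fun i j => bM j i, fun j => A.mulVec (bM j) = 0, ?_, ?_, ?_⟩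
  · have : (Matrix.of fun i j => bM j i : Matrix κ κ ℤ) = (Pi.basisFun ℤ κ).toMatrix bM := by
      ext i j
      simp [Module.Basis.toMatrix_apply]
    rw [this]
    exact (Module.Basis.isUnit_det _ bM)
  · intro j hj i
    exact congrFun hj i
  · intro y hy h
    rw [← Matrix.mulVec_mulVec, hAU] at h
    have hk : (∑ j, y j • bM j) ∈ LinearMap.ker A.mulVecLin := h
    have hpf : ∀ i, A.mulVec (bM (f i)) = 0 := by
      intro i
      have h1 : A.mulVec (bN i : κ → ℤ) = 0 := (bN i).2
      have ha : a i ≠ 0 := by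
        intro ha
        apply bN.ne_zero i
        ext1
        rw [snf, ha, zero_smul]; rfl
      rw [snf, Matrix.mulVec_smul] at h1
      exact (smul_eq_zero.1 h1).resolve_left ha
    have h2 := bN.sum_repr ⟨_, hk⟩
    have h3 : ∑ i, (bN.repr ⟨_, hk⟩ i * a i) • bM (f i) = ∑ j, y j • bM j := by
      have := congrArg Subtype.val h2
      rw [Submodule.coe_sum] at this
      simpa only [Submodule.coe_smul, snf, smul_smul] using this
    funext j
    by_cases hj : A.mulVec (bM j) = 0
    · exact hy j hj
    have h4 := congrArg (fun v => bM.repr v j) h3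
    simp only [map_sum, map_smul, Module.Basis.repr_self, Finsupp.coe_finsetSum, Finset.sum_apply,
      Finsupp.smul_apply, Finsupp.single_apply, smul_eq_mul, mul_ite, mul_one, mul_zero,
      Finset.sum_ite_eq', Finset.mem_univ, if_true] at h4
    rw [Pi.zero_apply, ← h4]
    refine Finset.sum_eq_zero fun i _ => if_neg ?_
    rintro rfl
    exact hj (hpf i)

theorem IsCanonicalFano.factorial_card_mul_volume_section_le {n : ℕ} {κ : Type*} [Fintype κ]
    {S : Set (Fin n → ℝ)} (hS : IsCanonicalFano S) (hS' : IsSimplexOfDim n S)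
    (A : Matrix (Fin n) κ ℤ) (hA : ∀ y, (A.map (Int.cast : ℤ → ℝ)).mulVec y = 0 → y = 0)
    (b : Fin n → ℝ) :
    (Fintype.card κ).factorial *
        volume {y : κ → ℝ | (A.map (Int.cast : ℤ → ℝ)).mulVec y + b ∈ polarDual S} ≤
      n.factorial * volume (polarDual S) := by
  let e := (Fintype.equivFin κ).symm
  have hmul : ∀ y : κ → ℝ, ((A.submatrix id e).map (Int.cast : ℤ → ℝ)).mulVec (y ∘ e) =
      (A.map (Int.cast : ℤ → ℝ)).mulVec y := by
    intro y
    funext i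
    exact Equiv.sum_comp e fun j => (A i j : ℝ) * y j
  have h := hS.factorial_mul_volume_section_le hS' (A.submatrix id e) (fun y hy => by
    have h1 := hmul (y ∘ e.symm)
    have h2 : (y ∘ e.symm) ∘ e = y := by funext i; simp
    rw [h2, hy] at h1
    rw [← h2, hA _ h1.symm]
    rfl) b
  convert h using 2
  have hm := (volume_measurePreserving_piCongrLeft (fun _ => ℝ) e).symm
  have := hm.measure_preimage_equiv
    {y : Fin (Fintype.card κ) → ℝ |
      ((A.submatrix id e).map (Int.cast : ℤ → ℝ)).mulVec y + b ∈ polarDual S}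
  rw [← this]
  congr 1
  ext y
  have hy : (MeasurableEquiv.piCongrLeft (fun _ => ℝ) e).symm y = y ∘ e := rfl
  simp only [mem_preimage, hy]
  change _ ↔ ((A.submatrix id e).map (Int.cast : ℤ → ℝ)).mulVec (y ∘ e) + b ∈ polarDual S
  rw [hmul]
  rfl

theorem volume_preimage_mulVec_map_intCast {κ : Type*} [Fintype κ] [DecidableEq κ]
    {U : Matrix κ κ ℤ} (hU : IsUnit U.det) {E : Set (κ → ℝ)} (hE : MeasurableSet E) :
    volume {w : κ → ℝ | (U.map (Int.cast : ℤ → ℝ)).mulVec w ∈ E} = volume E := by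
  have hdet : (U.map (Int.cast : ℤ → ℝ)).det = (U.det : ℝ) := by
    exact (RingHom.map_det (Int.castRingHom ℝ) U).symm
  have habs : |(U.map (Int.cast : ℤ → ℝ)).det| = 1 := by
    rw [hdet]
    rcases Int.isUnit_iff.1 hU with h | h <;> simp [h]
  have h0 : (U.map (Int.cast : ℤ → ℝ)).det ≠ 0 := by
    intro h
    simp [h] at habs
  have h := lintegral_comp_mulVec (U.map (Int.cast : ℤ → ℝ)) h0
    (F := E.indicator 1) (measurable_one.indicator hE)
  rw [habs, ENNReal.ofReal_one, one_mul, lintegral_indicator_one hE] at h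
  rw [h]
  have hm : Measurable fun w : κ → ℝ => (U.map (Int.cast : ℤ → ℝ)).mulVec w :=
    (Continuous.matrix_mulVec continuous_const continuous_id).measurable
  exact (lintegral_indicator_one (hm hE)).symm

theorem Nat.add_choose_le_add_choose {a b c d : ℕ} (h₁ : a ≤ c) (h₂ : b ≤ d) :
    (a + b).choose a ≤ (c + d).choose c := by
  calc (a + b).choose a ≤ (a + d).choose a := Nat.choose_le_choose _ (by omega)
    _ = (a + d).choose d := by
        rw [add_comm, Nat.choose_symm_add]
    _ ≤ (c + d).choose d := Nat.choose_le_choose _ (by omega)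
    _ = (c + d).choose c := by
        rw [add_comm, Nat.choose_symm_add]

theorem Matrix.card_le_of_mulVec_map_intCast {n : ℕ} {κ : Type*} [Fintype κ]
    (A : Matrix (Fin n) κ ℤ) (hA : ∀ y, (A.map (Int.cast : ℤ → ℝ)).mulVec y = 0 → y = 0) :
    Fintype.card κ ≤ n := by
  have := LinearMap.finrank_le_finrank_of_injective (f := (A.map (Int.cast : ℤ → ℝ)).mulVecLin)
    (LinearMap.ker_eq_bot.1 (LinearMap.ker_eq_bot'.2 hA))
  simpa using this

theorem Matrix.mulVec_eq_submatrix_add {m κ : Type*} [Fintype κ] (p : κ → Prop) [DecidablePred p]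
    (M : Matrix m κ ℝ) (w : κ → ℝ) :
    M.mulVec w = (M.submatrix id (Subtype.val : {j // p j} → κ)).mulVec (fun j => w j) +
      (M.submatrix id (Subtype.val : {j // ¬p j} → κ)).mulVec (fun j => w j) := by
  funext i
  exact (Fintype.sum_subtype_add_sum_subtype p fun j => M i j * w j).symm

theorem measurableSet_setOf_mulVec_add_mem {m κ : Type*} [Fintype κ] [Fintype m]
    (M : Matrix m κ ℝ) (b : m → ℝ) {T : Set (m → ℝ)} (hT : MeasurableSet T) :
    MeasurableSet {y : κ → ℝ | M.mulVec y + b ∈ T} := by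
  have : Measurable fun y : κ → ℝ => M.mulVec y + b :=
    ((Continuous.matrix_mulVec continuous_const continuous_id).add continuous_const).measurable
  exact this hT

theorem volume_pi_le_mul_of_forall_volume_section_le {κ : Type*} [Fintype κ] (p : κ → Prop)
    [DecidablePred p] {Y : Set ({j // ¬p j} → ℝ)} (hY : MeasurableSet Y)
    {Z : Set (({j // p j} → ℝ) × ({j // ¬p j} → ℝ))} (hZ : MeasurableSet Z) {K : ℝ≥0∞} (c : ℝ≥0∞)
    (hZK : ∀ v, c * volume {u | (u, v) ∈ Z} ≤ K) :
    c * volume {w : κ → ℝ | (fun j : {j // ¬p j} => w j) ∈ Y ∧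
      ((fun j : {j // p j} => w j), fun j : {j // ¬p j} => w j) ∈ Z} ≤ K * volume Y := by
  have hE : MeasurableSet (Prod.snd ⁻¹' Y ∩ Z) := (measurable_snd hY).inter hZ
  have h := (volume_preserving_piEquivPiSubtypeProd (fun _ : κ => ℝ) p).measure_preimage
    hE.nullMeasurableSet
  have h1 : {w : κ → ℝ | (fun j : {j // ¬p j} => w j) ∈ Y ∧
      ((fun j : {j // p j} => w j), fun j : {j // ¬p j} => w j) ∈ Z} =
      MeasurableEquiv.piEquivPiSubtypeProd (fun _ : κ => ℝ) p ⁻¹' (Prod.snd ⁻¹' Y ∩ Z) := rfl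
  rw [h1, h, Measure.volume_eq_prod, Measure.prod_apply_symm hE,
    ← lintegral_const_mul _ (measurable_measure_prodMk_right hE)]
  calc _ ≤ ∫⁻ v, Y.indicator (fun _ => K) v := by
        refine lintegral_mono fun v => ?_
        by_cases hv : v ∈ Y
        · rw [indicator_of_mem hv]
          refine le_trans ?_ (hZK v)
          gcongr
          exact fun u hu => hu.2
        · rw [indicator_of_notMem hv]
          have : (fun x => (x, v)) ⁻¹' (Prod.snd ⁻¹' Y ∩ Z) = ∅ := by
            ext u; simp [hv]
          simp [this]
    _ = K * volume Y := by rw [lintegral_indicator_const hY]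

theorem factorial_card_mul_volume_setOf_forall_mulVec_add_mem_le {ι : Type*} [DecidableEq ι]
    (n : ι → ℕ) (T : ∀ i, Set (Fin (n i) → ℝ)) (hT : ∀ i, MeasurableSet (T i))
    (hsec : ∀ (i : ι) (κ : Type) [Fintype κ] (A : Matrix (Fin (n i)) κ ℤ),
      (∀ y, (A.map (Int.cast : ℤ → ℝ)).mulVec y = 0 → y = 0) → ∀ b,
        (Fintype.card κ).factorial * volume {y | (A.map (Int.cast : ℤ → ℝ)).mulVec y + b ∈ T i} ≤
          (n i).factorial * volume (T i)) (s : Finset ι) :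
    ∀ (κ : Type) [Fintype κ] (A : ∀ i, Matrix (Fin (n i)) κ ℤ),
      (∀ y, (∀ i ∈ s, ((A i).map (Int.cast : ℤ → ℝ)).mulVec y = 0) → y = 0) →
      Fintype.card κ ≤ ∑ i ∈ s, n i ∧ ∀ b : ∀ i, Fin (n i) → ℝ,
        (Fintype.card κ).factorial *
            volume {y | ∀ i ∈ s, ((A i).map (Int.cast : ℤ → ℝ)).mulVec y + b i ∈ T i} ≤
          (∑ i ∈ s, n i).factorial * ∏ i ∈ s, volume (T i) := by
  classical
  induction s using Finset.induction_on with
  | empty =>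
    intro κ _ A hA
    have : IsEmpty κ := ⟨fun j => by
      have := congrFun (hA (fun _ => 1) (by simp)) j
      simp at this⟩
    simp [volume_pi]
  | insert i₀ s hi₀ ih =>
    intro κ _ A hA
    obtain ⟨U, p, hU, hUp, hUinj⟩ := (A i₀).exists_unimodular_mul_splitting
    have hcastmul : ∀ i, ((A i * U).map (Int.cast : ℤ → ℝ)) =
        (A i).map (Int.cast : ℤ → ℝ) * U.map (Int.cast : ℤ → ℝ) := fun i =>
      Matrix.map_mul (f := Int.castRingHom ℝ)
    have hUR : ∀ y : κ → ℝ, (U.map (Int.cast : ℤ → ℝ)).mulVec y = 0 → y = 0 := by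
      intro y hy
      refine U.mulVec_map_intCast_eq_zero (fun z hz => ?_) y hy
      exact Matrix.eq_zero_of_mulVec_eq_zero hU.ne_zero hz
    let val₁ : {j // ¬p j} → κ := Subtype.val
    let val₂ : {j // p j} → κ := Subtype.val
    let B : ∀ i, Matrix (Fin (n i)) {j // ¬p j} ℤ := fun i => (A i * U).submatrix id val₁
    let C : ∀ i, Matrix (Fin (n i)) {j // p j} ℤ := fun i => (A i * U).submatrix id val₂
    have hsplit : ∀ i (w : κ → ℝ), ((A i).map (Int.cast : ℤ → ℝ)).mulVec
        ((U.map (Int.cast : ℤ → ℝ)).mulVec w) =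
        ((C i).map (Int.cast : ℤ → ℝ)).mulVec (fun j => w j) +
          ((B i).map (Int.cast : ℤ → ℝ)).mulVec (fun j => w j) := by
      intro i w
      rw [Matrix.mulVec_mulVec, ← hcastmul, Matrix.mulVec_eq_submatrix_add p]
      rfl
    have hC₀ : C i₀ = 0 := by
      ext i j
      exact hUp j j.2 i
    have hBinj : ∀ y, ((B i₀).map (Int.cast : ℤ → ℝ)).mulVec y = 0 → y = 0 := by
      refine Matrix.mulVec_map_intCast_eq_zero _ fun y hy => ?_
      have h := hUinj (fun j => if hj : p j then 0 else y ⟨j, hj⟩)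
        (fun j hj => by simp [hj]) (by
          funext i
          have h1 := congrFun hy i
          rw [← h1]
          simp only [Matrix.mulVec, dotProduct]
          rw [← Fintype.sum_subtype_add_sum_subtype p]
          rw [Finset.sum_eq_zero fun j _ => by simp [j.2], zero_add]
          refine Finset.sum_congr rfl fun j _ => ?_
          simp [j.2, B, val₁])
      funext j
      simpa [j.2] using congrFun h j
    have hCinj : ∀ y, (∀ i ∈ s, ((C i).map (Int.cast : ℤ → ℝ)).mulVec y = 0) → y = 0 := by
      intro y hy
      let w : κ → ℝ := fun j => if hj : p j then y ⟨j, hj⟩ else 0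
      have hw₁ : (fun j : {j // ¬p j} => w j) = 0 := by
        funext j
        simp [w, j.2]
      have hw₂ : (fun j : {j // p j} => w j) = y := by
        funext j
        simp [w, j.2]
      have hw : w = 0 := by
        apply hUR
        apply hA
        intro i hi
        rw [hsplit, hw₁, hw₂, Matrix.mulVec_zero, add_zero]
        rcases Finset.mem_insert.1 hi with rfl | hi
        · rw [hC₀]
          funext; simp [Matrix.mulVec, dotProduct]
        · exact hy i hi
      rw [← hw₂, hw]
      rfl
    have hk₁ := (B i₀).card_le_of_mulVec_map_intCast hBinj
    obtain ⟨hk₂, hvol₂⟩ := ih {j // p j} C hCinj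
    have hcard : Fintype.card κ = Fintype.card {j // ¬p j} + Fintype.card {j // p j} := by
      rw [Fintype.card_subtype_compl, Nat.sub_add_cancel (Fintype.card_subtype_le p)]
    rw [Finset.sum_insert hi₀, hcard]
    refine ⟨add_le_add hk₁ hk₂, fun b => ?_⟩
    have hEm : MeasurableSet {y : κ → ℝ | ∀ i ∈ insert i₀ s,
        ((A i).map (Int.cast : ℤ → ℝ)).mulVec y + b i ∈ T i} := by
      have : {y : κ → ℝ | ∀ i ∈ insert i₀ s,
          ((A i).map (Int.cast : ℤ → ℝ)).mulVec y + b i ∈ T i} = ⋂ i ∈ insert i₀ s,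
          {y : κ → ℝ | ((A i).map (Int.cast : ℤ → ℝ)).mulVec y + b i ∈ T i} := by
        ext; simp
      rw [this]
      exact Finset.measurableSet_biInter _ fun i _ =>
        measurableSet_setOf_mulVec_add_mem _ _ (hT i)
    let Y : Set ({j // ¬p j} → ℝ) :=
      {v | ((B i₀).map (Int.cast : ℤ → ℝ)).mulVec v + b i₀ ∈ T i₀}
    let Z : Set (({j // p j} → ℝ) × ({j // ¬p j} → ℝ)) := {uv | ∀ i ∈ s,
      ((C i).map (Int.cast : ℤ → ℝ)).mulVec uv.1 +
        (((B i).map (Int.cast : ℤ → ℝ)).mulVec uv.2 + b i) ∈ T i}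
    have hZm : MeasurableSet Z := by
      have : Z = ⋂ i ∈ s, {uv | ((C i).map (Int.cast : ℤ → ℝ)).mulVec uv.1 +
        (((B i).map (Int.cast : ℤ → ℝ)).mulVec uv.2 + b i) ∈ T i} := by
        ext; simp [Z]
      rw [this]
      refine Finset.measurableSet_biInter _ fun i _ => ?_
      have : Measurable fun uv : ({j // p j} → ℝ) × ({j // ¬p j} → ℝ) =>
          ((C i).map (Int.cast : ℤ → ℝ)).mulVec uv.1 +
            (((B i).map (Int.cast : ℤ → ℝ)).mulVec uv.2 + b i) :=
        ((Continuous.matrix_mulVec continuous_const continuous_fst).add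
          ((Continuous.matrix_mulVec continuous_const continuous_snd).add
            continuous_const)).measurable
      exact this (hT i)
    have hYm : MeasurableSet Y := measurableSet_setOf_mulVec_add_mem _ _ (hT i₀)
    have hvolE := volume_preimage_mulVec_map_intCast hU hEm
    have hEeq : {w : κ → ℝ | (U.map (Int.cast : ℤ → ℝ)).mulVec w ∈ {y : κ → ℝ |
        ∀ i ∈ insert i₀ s, ((A i).map (Int.cast : ℤ → ℝ)).mulVec y + b i ∈ T i}} =
        {w : κ → ℝ | (fun j : {j // ¬p j} => w j) ∈ Y ∧
          ((fun j : {j // p j} => w j), fun j : {j // ¬p j} => w j) ∈ Z} := by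
      ext w
      simp only [mem_ofPred_eq, Finset.forall_mem_insert, hsplit, Y, Z, hC₀, add_assoc]
      refine and_congr_left fun _ => ?_
      have : ((0 : Matrix (Fin (n i₀)) {j // p j} ℤ).map (Int.cast : ℤ → ℝ)).mulVec
          (fun j => w j) = 0 := by
        funext; simp [Matrix.mulVec, dotProduct]
      rw [this, zero_add]
    have hmain := volume_pi_le_mul_of_forall_volume_section_le p hYm hZm
      ((Fintype.card {j // p j}).factorial : ℝ≥0∞) fun v => hvol₂ fun i =>
        ((B i).map (Int.cast : ℤ → ℝ)).mulVec v + b i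
    rw [← hvolE, hEeq, Finset.prod_insert hi₀]
    have hY := hsec i₀ {j // ¬p j} (B i₀) hBinj (b i₀)
    have hfac : ∀ a b : ℕ, ((a + b).factorial : ℝ≥0∞) =
        (a + b).choose a * a.factorial * b.factorial := fun a b => by
      rw [Nat.choose_symm_add]
      exact_mod_cast (Nat.add_choose_mul_factorial_mul_factorial a b).symm
    rw [hfac, hfac]
    calc _ ≤ (((Fintype.card {j // ¬p j} + Fintype.card {j // p j}).choose
          (Fintype.card {j // ¬p j}) : ℕ) : ℝ≥0∞) * (Fintype.card {j // ¬p j}).factorial *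
          ((∑ i ∈ s, n i).factorial * (∏ i ∈ s, volume (T i)) * volume Y) := by
          rw [mul_assoc _ ((Fintype.card {j // p j}).factorial : ℝ≥0∞)]
          gcongr
      _ = (((Fintype.card {j // ¬p j} + Fintype.card {j // p j}).choose
          (Fintype.card {j // ¬p j}) : ℕ) : ℝ≥0∞) * ((∑ i ∈ s, n i).factorial *
          (∏ i ∈ s, volume (T i)) * ((Fintype.card {j // ¬p j}).factorial * volume Y)) := by
          ring
      _ ≤ (((n i₀ + ∑ i ∈ s, n i).choose (n i₀) : ℕ) : ℝ≥0∞) * ((∑ i ∈ s, n i).factorial *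
          (∏ i ∈ s, volume (T i)) * ((n i₀).factorial * volume (T i₀))) := by
          gcongr ?_ * (_ * ?_)
          exact_mod_cast Nat.add_choose_le_add_choose hk₁ hk₂
      _ = _ := by ring

theorem convexHull_iUnion_single_mem_nhds {ι : Type*} [Fintype ι] [DecidableEq ι] [Nonempty ι] {n : ι → ℕ}
    (S : ∀ i, Set (Fin (n i) → ℝ)) (hS : ∀ i, S i ∈ nhds 0) :
    convexHull ℝ (⋃ i, (fun x => (Pi.single i x : ∀ i, Fin (n i) → ℝ)) '' S i) ∈ nhds 0 := by
  have hc : (0 : ℝ) < Fintype.card ι := by exact_mod_cast Fintype.card_pos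
  have h : ∀ᶠ x : ∀ i, Fin (n i) → ℝ in nhds 0, ∀ i, (Fintype.card ι : ℝ) • x i ∈ S i := by
    rw [Filter.eventually_all]
    intro i
    have hcont : Continuous fun x : ∀ i, Fin (n i) → ℝ => (Fintype.card ι : ℝ) • x i := by fun_prop
    have := hcont.tendsto 0
    simp only [Pi.zero_apply, smul_zero] at this
    exact this (hS i)
  filter_upwards [h] with x hx
  have hsum : x = ∑ i, (Fintype.card ι : ℝ)⁻¹ •
      (Pi.single i ((Fintype.card ι : ℝ) • x i) : ∀ i, Fin (n i) → ℝ) := by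
    simp only [← Pi.single_smul, smul_smul, inv_mul_cancel₀ hc.ne', one_smul]
    exact (Finset.univ_sum_single x).symm
  rw [hsum]
  refine (convex_convexHull ℝ _).sum_mem (fun _ _ => (inv_pos.2 hc).le) ?_ fun i _ => ?_
  · simp [hc.ne']
  · exact subset_convexHull ℝ _ (mem_iUnion.2 ⟨i, mem_image_of_mem _ (hx i)⟩)

theorem surjective_of_image_latticePts {d : ℕ} {E : Type*} [AddCommGroup E] [Module ℝ E]
    (φ : E →ₗ[ℝ] (Fin d → ℝ)) {Λ : Set E} (hφ : φ '' Λ = {y | IsLatticePt y}) :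
    Function.Surjective φ := by
  have h : ∀ j, ∃ x, φ x = Pi.single j 1 := by
    intro j
    have : (Pi.single j 1 : Fin d → ℝ) ∈ φ '' Λ := by
      rw [hφ]
      intro i
      exact ⟨(Pi.single j 1 : Fin d → ℤ) i, by simp [Pi.single_apply]⟩
    obtain ⟨x, -, hx⟩ := this
    exact ⟨x, hx⟩
  choose x hx using h
  intro y
  refine ⟨∑ j, y j • x j, ?_⟩
  simp only [map_sum, map_smul, hx]
  exact (pi_eq_sum_univ' y).symm

/-- Let `Sᵢ ⊂ ℝ^{dᵢ}` be canonical Fano simplices, `D = d₁ + ⋯ + d_t`,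
and `φ : ℝ^{d₁} × ⋯ × ℝ^{d_t} → ℝ^d` a linear map with `φ(ℤ^D) = ℤ^d`. If
`P = φ(S₁ ⊕ ⋯ ⊕ S_t)`, then `0 ∈ int P` and
`vol(P*) ≤ (D! / d!) · vol(S₁*) ⋯ vol(S_t*)`. -/
theorem dual_volume_free_sum_bound (t : ℕ) (ht : 2 ≤ t) (d : ℕ) (dvec : Fin t → ℕ)
    (hd1 : ∀ i, 1 ≤ dvec i) (S : (i : Fin t) → Set (Fin (dvec i) → ℝ))
    (hS : ∀ i, IsCanonicalFano (S i) ∧ IsSimplexOfDim (dvec i) (S i))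
    (φ : ((i : Fin t) → (Fin (dvec i) → ℝ)) →ₗ[ℝ] (Fin d → ℝ))
    (hφ : φ '' {x | ∀ i, IsLatticePt (x i)} = {y | IsLatticePt y})
    (P : Set (Fin d → ℝ))
    (hP : P = φ '' convexHull ℝ (⋃ i, (fun x => Pi.single i x) '' S i)) :
    0 ∈ interior P ∧
      volume (polarDual P) ≤
        (((∑ i, dvec i).factorial : ℝ≥0∞) / (d.factorial : ℝ≥0∞)) *
          ∏ i, volume (polarDual (S i)) := by
  have hsurj := surjective_of_image_latticePts φ hφ
  constructor
  · have : Nonempty (Fin t) := ⟨⟨0, by omega⟩⟩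
    have hnhds := convexHull_iUnion_single_mem_nhds S fun i => by
      have h : (0 : Fin (dvec i) → ℝ) ∈ {x ∈ interior (S i) | IsLatticePt x} := by
        rw [(hS i).1.2]
        rfl
      exact mem_interior_iff_mem_nhds.1 h.1
    have hopen : IsOpenMap φ := φ.isOpenMap_of_finiteDimensional hsurj
    have := hopen.image_mem_nhds hnhds
    rw [map_zero, ← hP] at this
    exact mem_interior_iff_mem_nhds.2 this
  · have h_int : ∀ i a j, ∃ z : ℤ, φ (Pi.single i (Pi.single a 1)) j = z := by
      intro i a
      have : φ (Pi.single i (Pi.single a 1)) ∈ {y | IsLatticePt y} := by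
        rw [← hφ]
        refine mem_image_of_mem _ fun l b => ?_
        refine ⟨(Pi.single i (Pi.single a 1) : ∀ i, Fin (dvec i) → ℤ) l b, ?_⟩
        rcases eq_or_ne l i with rfl | hl
        · simp [Pi.single_apply]
        · simp [hl]
      exact this
    choose M hM using h_int
    have hφM : ∀ (y : Fin d → ℝ) i x, ∑ j, y j * φ (Pi.single i x) j =
        ∑ a, ((Matrix.of (M i)).map (Int.cast : ℤ → ℝ)).mulVec y a * x a := by
      intro y i x
      have hx : (Pi.single i x : ∀ i, Fin (dvec i) → ℝ) =
          ∑ a, x a • Pi.single i (Pi.single a 1) := by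
        have h1 := congrArg (LinearMap.single ℝ (fun i => Fin (dvec i) → ℝ) i) (pi_eq_sum_univ' x)
        simp only [map_sum, map_smul] at h1
        exact h1
      simp only [hx, map_sum, map_smul, Finset.sum_apply, Pi.smul_apply, smul_eq_mul, hM,
        Matrix.mulVec, dotProduct, Matrix.map_apply, Matrix.of_apply, Finset.mul_sum,
        Finset.sum_mul]
      rw [Finset.sum_comm]
      exact Finset.sum_congr rfl fun _ _ => Finset.sum_congr rfl fun _ _ => by ring
    have hker : ∀ y : Fin d → ℝ,
        (∀ i ∈ Finset.univ, ((Matrix.of (M i)).map (Int.cast : ℤ → ℝ)).mulVec y = 0) → y = 0 := by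
      intro y hy
      obtain ⟨x, hx⟩ := hsurj y
      have h0 : ∑ j, y j * φ x j = 0 := by
        conv_lhs => rw [← Finset.univ_sum_single x]
        simp only [map_sum, Finset.sum_apply, Finset.mul_sum]
        rw [Finset.sum_comm]
        refine Finset.sum_eq_zero fun i hi => ?_
        rw [hφM, hy i hi]
        simp
      rw [hx, Finset.sum_eq_zero_iff_of_nonneg fun j _ => mul_self_nonneg (y j)] at h0
      funext j
      exact mul_self_eq_zero.1 (h0 j (Finset.mem_univ j))
    have h := (factorial_card_mul_volume_setOf_forall_mulVec_add_mem_le dvec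
      (fun i => polarDual (S i)) (fun i => measurableSet_polarDual_of_isSimplexOfDim (hS i).2)
      (fun i κ _ A hA b => (hS i).1.factorial_card_mul_volume_section_le (hS i).2 A hA b)
      Finset.univ (Fin d) (fun i => Matrix.of (M i)) hker).2 0
    have hsub : polarDual P ⊆ {y | ∀ i ∈ Finset.univ,
        ((Matrix.of (M i)).map (Int.cast : ℤ → ℝ)).mulVec y +
          (0 : ∀ i, Fin (dvec i) → ℝ) i ∈ polarDual (S i)} := by
      intro y hy i _ x hx
      rw [Pi.zero_apply, add_zero, ← hφM]
      refine hy _ ?_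
      rw [hP]
      exact mem_image_of_mem _ (subset_convexHull ℝ _ (mem_iUnion.2 ⟨i, mem_image_of_mem _ hx⟩))
    rw [Fintype.card_fin] at h
    rw [← ENNReal.mul_div_right_comm, ENNReal.le_div_iff_mul_le (Or.inl (by positivity))
      (Or.inl (by simp)), mul_comm]
    exact (mul_le_mul_right (measure_mono hsub) _).trans h
end

section
/- Let P ⊂ ℝ^d be a canonical Fano polytope such that P = conv(S_1 ∪ S_2), where S_1 and S_2 are simplices of dimensions d_1 and d_2 with vertices in vert(P), each containing 0 in its relative interior. Set 𝒱 = vert(S_1) ∩ vert(S_2), q = |𝒱|, and assume d_1 + d_2 = d + q and 𝒱 ≠ vert(S_i) for i = 1, 2. Let (β_{i,v})_{v ∈ vert(S_i)} be the barycentric coordinates of the origin in S_i. Then for any choice of vertices v_1 ∈ vert(S_1) ∖ 𝒱 and v_2 ∈ vert(S_2) ∖ 𝒱, one has vol(P*) ≤ (1/2) Σ_{i=1,2} [ (2(d_i − q))! / ( (2d_i − q)! · ((d_i − q)!)^2 ) ] · Π_{v ∈ 𝒱} (1/β_{i,v}) · Π_{v ∈ vert(S_i) ∖ (𝒱 ∪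 {v_i})} (1/β_{i,v}^2). -/
open MeasureTheory Set
open scoped ENNReal

/-- The normalized truncated power `s₊ ^ n / n!`, where the zeroth power is the indicator of
`[0, ∞)`. -/
noncomputable def truncPow (n : ℕ) (s : ℝ) : ℝ := if 0 ≤ s then s ^ n / n.factorial else 0

theorem truncPow_nonneg (n : ℕ) (s : ℝ) : 0 ≤ truncPow n s := by
  unfold truncPow; split_ifs <;> positivity

@[fun_prop]
theorem measurable_truncPow (n : ℕ) : Measurable (truncPow n) :=
  Measurable.ite measurableSet_Ici (by fun_prop) measurable_const

theorem truncPow_sq (n : ℕ) (s : ℝ) :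
    truncPow n s ^ 2 = (2 * n).factorial / (n.factorial : ℝ) ^ 2 * truncPow (2 * n) s := by
  unfold truncPow
  split_ifs
  · have := Nat.factorial_ne_zero (2 * n)
    field_simp
    ring
  · simp

/-- Lebesgue measure on the nonnegative orthant. -/
noncomputable def orthantMeasure (ι : Type*) [Fintype ι] : Measure (ι → ℝ) :=
  Measure.pi fun _ => (volume : Measure ℝ).restrict (Ici 0)

instance (ι : Type*) [Fintype ι] : SigmaFinite (orthantMeasure ι) := by
  unfold orthantMeasure; infer_instance

theorem orthantMeasure_eq (ι : Type*) [Fintype ι] :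
    orthantMeasure ι = volume.restrict (Ici (0 : ι → ℝ)) := by
  rw [orthantMeasure, ← Measure.restrict_pi_pi, pi_univ_Ici]
  rfl

theorem lintegral_truncPow_sub_mul (n : ℕ) (s : ℝ) {b : ℝ} (hb : 0 < b) :
    ∫⁻ t in Ici 0, ENNReal.ofReal (truncPow n (s - b * t)) =
      ENNReal.ofReal (truncPow (n + 1) s * (1 / b)) := by
  have hind : ∀ t ∈ Ici (0 : ℝ), ENNReal.ofReal (truncPow n (s - b * t)) =
      (Iic (s / b)).indicator (fun t => ENNReal.ofReal ((s - b * t) ^ n / n.factorial)) t := by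
    intro t _
    have : 0 ≤ s - b * t ↔ t ≤ s / b := by rw [le_div_iff₀ hb, sub_nonneg, mul_comm]
    by_cases h : t ≤ s / b
    · rw [indicator_of_mem (by exact h), truncPow, if_pos (this.2 h)]
    · rw [indicator_of_notMem (by exact h), truncPow, if_neg (by rwa [this]), ENNReal.ofReal_zero]
  rw [setLIntegral_congr_fun measurableSet_Ici hind, setLIntegral_indicator measurableSet_Iic,
    inter_comm, Ici_inter_Iic]
  by_cases hs : 0 ≤ s
  · have hsb : 0 ≤ s / b := by positivity
    rw [← ofReal_integral_eq_lintegral_ofReal]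
    · congr 1
      rw [integral_Icc_eq_integral_Ioc, ← intervalIntegral.integral_of_le hsb,
        intervalIntegral.integral_eq_sub_of_hasDerivAt
          (f := fun t => -((s - b * t) ^ (n + 1) / ((n + 1).factorial * b)))]
      · rw [truncPow, if_pos hs, mul_div_cancel₀ _ hb.ne']
        simp
        field_simp
      · intro t _
        have h := (((((hasDerivAt_id t).const_mul b).const_sub s).pow (n + 1)).div_const
          (((n + 1).factorial : ℝ) * b)).neg
        refine h.congr_deriv ?_
        rw [Nat.factorial_succ]
        push_cast
        simp
        field_simp
      · exact Continuous.intervalIntegrable (by fun_prop) _ _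
    · exact (Continuous.continuousOn (by fun_prop)).integrableOn_Icc
    · filter_upwards [ae_restrict_mem measurableSet_Icc] with t ht
      have : t * b ≤ s := (le_div_iff₀ hb).1 ht.2
      have : 0 ≤ s - b * t := by linarith
      simp only [Pi.zero_apply]
      positivity
  · rw [Icc_eq_empty, truncPow, if_neg hs]
    · simp
    · rw [not_le] at hs ⊢
      exact div_neg_of_neg_of_pos hs hb

theorem lintegral_truncPow_sub_sum_fin (k n : ℕ) (s : ℝ) {b : Fin k → ℝ} (hb : ∀ i, 0 < b i) :
    ∫⁻ z, ENNReal.ofReal (truncPow n (s - ∑ i, b i * z i)) ∂orthantMeasure (Fin k) =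
      ENNReal.ofReal (truncPow (n + k) s * ∏ i, 1 / b i) := by
  induction k generalizing s with
  | zero => simp [orthantMeasure]
  | succ k ih =>
    have hmp := measurePreserving_piFinSuccAbove
      (fun _ : Fin (k + 1) => (volume : Measure ℝ).restrict (Ici 0)) 0
    rw [orthantMeasure, ← hmp.symm.lintegral_comp (by fun_prop), lintegral_prod _ (by fun_prop)]
    simp only [Fin.sum_univ_succ, MeasurableEquiv.piFinSuccAbove_symm_apply, Fin.insertNthEquiv,
      Equiv.coe_fn_mk, Fin.insertNth_zero, Fin.cons_zero, Fin.cons_succ, ← sub_sub]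
    change ∫⁻ t in Ici 0, ∫⁻ z : Fin k → ℝ, ENNReal.ofReal
      (truncPow n (s - b 0 * t - ∑ i, b i.succ * z i)) ∂orthantMeasure (Fin k) = _
    simp_rw [ih _ (b := fun i => b i.succ) (fun i => hb _)]
    have hp : 0 ≤ ∏ i : Fin k, 1 / b i.succ :=
      Finset.prod_nonneg fun i _ => (one_div_pos.2 (hb _)).le
    simp_rw [ENNReal.ofReal_mul (truncPow_nonneg _ _)]
    rw [lintegral_mul_const _ (by fun_prop), lintegral_truncPow_sub_mul _ _ (hb 0),
      ← ENNReal.ofReal_mul (mul_nonneg (truncPow_nonneg _ _) (one_div_pos.2 (hb _)).le),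
      Fin.prod_univ_succ, ← ENNReal.ofReal_mul (truncPow_nonneg _ _), mul_assoc, add_assoc]

theorem lintegral_truncPow_sub_sum {ι : Type*} [Fintype ι] (n : ℕ) (s : ℝ) {b : ι → ℝ}
    (hb : ∀ i, 0 < b i) :
    ∫⁻ z, ENNReal.ofReal (truncPow n (s - ∑ i, b i * z i)) ∂orthantMeasure ι =
      ENNReal.ofReal (truncPow (n + Fintype.card ι) s * ∏ i, 1 / b i) := by
  let e := (Fintype.equivFin ι).symm
  have hmp := measurePreserving_piCongrLeft
    (fun _ : ι => (volume : Measure ℝ).restrict (Ici 0)) e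
  rw [orthantMeasure, ← hmp.lintegral_comp (by fun_prop), ← e.prod_comp,
    ← lintegral_truncPow_sub_sum_fin _ n s (fun i => hb (e i))]
  simp_rw [← e.sum_comp, MeasurableEquiv.coe_piCongrLeft, Equiv.piCongrLeft_apply_apply]
  rfl

theorem orthantMeasure_sum_le {ι : Type*} [Fintype ι] (s : ℝ) {b : ι → ℝ} (hb : ∀ i, 0 < b i) :
    orthantMeasure ι {z | ∑ i, b i * z i ≤ s} =
      ENNReal.ofReal (truncPow (Fintype.card ι) s * ∏ i, 1 / b i) := by
  rw [← zero_add (Fintype.card ι), ← lintegral_truncPow_sub_sum 0 s hb,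
    ← lintegral_indicator_one (measurableSet_le (by fun_prop) (by fun_prop))]
  congr with z
  simp [indicator, truncPow]
  split_ifs <;> simp

/-- An upper bound for the volume of the region of the nonnegative orthant cut out by two linear
inequalities that share only the first block of coordinates. -/
theorem orthantMeasure_prod_le {α A B : Type*} [Fintype α] [Fintype A] [Fintype B]
    {b b' : α → ℝ} {a : A → ℝ} {c : B → ℝ} (hb : ∀ i, 0 < b i) (hb' : ∀ i, 0 < b' i)
    (ha : ∀ i, 0 < a i) (hc : ∀ i, 0 < c i) :
    (orthantMeasure α).prod ((orthantMeasure A).prod (orthantMeasure B))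
        {z | ∑ i, b i * z.1 i + ∑ i, a i * z.2.1 i ≤ 1 ∧
          ∑ i, b' i * z.1 i + ∑ i, c i * z.2.2 i ≤ 1} ≤
      ENNReal.ofReal ((1 / 2) *
        ((2 * Fintype.card A).factorial /
            ((2 * Fintype.card A + Fintype.card α).factorial *
              ((Fintype.card A).factorial : ℝ) ^ 2) *
            (∏ i, 1 / b i) * (∏ i, 1 / a i ^ 2) +
          (2 * Fintype.card B).factorial /
            ((2 * Fintype.card B + Fintype.card α).factorial *
              ((Fintype.card B).factorial : ℝ) ^ 2) *
            (∏ i, 1 / b' i) * (∏ i, 1 / c i ^ 2))) := by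
  set m := Fintype.card A
  set n := Fintype.card B
  have hbp : 0 ≤ ∏ i, 1 / b i := Finset.prod_nonneg fun i _ => (one_div_pos.2 (hb _)).le
  have hbp' : 0 ≤ ∏ i, 1 / b' i := Finset.prod_nonneg fun i _ => (one_div_pos.2 (hb' _)).le
  have hap : 0 ≤ ∏ i, 1 / a i := Finset.prod_nonneg fun i _ => (one_div_pos.2 (ha _)).le
  have hcp : 0 ≤ ∏ i, 1 / c i := Finset.prod_nonneg fun i _ => (one_div_pos.2 (hc _)).le
  let Ka : ℝ := 1 / 2 * ((2 * m).factorial / (m.factorial : ℝ) ^ 2) * (∏ i, 1 / a i) ^ 2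
  let Kc : ℝ := 1 / 2 * ((2 * n).factorial / (n.factorial : ℝ) ^ 2) * (∏ i, 1 / c i) ^ 2
  have hKa : 0 ≤ Ka := by positivity
  have hKc : 0 ≤ Kc := by positivity
  have hmeas : MeasurableSet {z : (α → ℝ) × (A → ℝ) × (B → ℝ) |
      ∑ i, b i * z.1 i + ∑ i, a i * z.2.1 i ≤ 1 ∧
        ∑ i, b' i * z.1 i + ∑ i, c i * z.2.2 i ≤ 1} := by
    rw [ofPred_and]
    exact (measurableSet_le (by fun_prop) (by fun_prop)).inter
      (measurableSet_le (by fun_prop) (by fun_prop))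
  rw [Measure.prod_apply hmeas]
  calc
    _ ≤ ∫⁻ x, (ENNReal.ofReal Ka * ENNReal.ofReal (truncPow (2 * m) (1 - ∑ i, b i * x i)) +
          ENNReal.ofReal Kc * ENNReal.ofReal (truncPow (2 * n) (1 - ∑ i, b' i * x i)))
          ∂orthantMeasure α := by
      refine lintegral_mono fun x => ?_
      have hslice : Prod.mk x ⁻¹' {z : (α → ℝ) × (A → ℝ) × (B → ℝ) |
          ∑ i, b i * z.1 i + ∑ i, a i * z.2.1 i ≤ 1 ∧
            ∑ i, b' i * z.1 i + ∑ i, c i * z.2.2 i ≤ 1} =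
          {y : A → ℝ | ∑ i, a i * y i ≤ 1 - ∑ i, b i * x i} ×ˢ
            {y : B → ℝ | ∑ i, c i * y i ≤ 1 - ∑ i, b' i * x i} := by
        ext y
        simp [le_sub_iff_add_le']
      simp only [hslice]
      rw [Measure.prod_prod, orthantMeasure_sum_le _ ha, orthantMeasure_sum_le _ hc,
        ← ENNReal.ofReal_mul (mul_nonneg (truncPow_nonneg _ _) hap), ← ENNReal.ofReal_mul hKa,
        ← ENNReal.ofReal_mul hKc,
        ← ENNReal.ofReal_add (mul_nonneg hKa (truncPow_nonneg _ _))
          (mul_nonneg hKc (truncPow_nonneg _ _))]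
      apply ENNReal.ofReal_le_ofReal
      have h1 := truncPow_sq m (1 - ∑ i, b i * x i)
      have h2 := truncPow_sq n (1 - ∑ i, b' i * x i)
      have h3 := two_mul_le_add_sq (truncPow m (1 - ∑ i, b i * x i) * ∏ i, 1 / a i)
        (truncPow n (1 - ∑ i, b' i * x i) * ∏ i, 1 / c i)
      rw [mul_pow, mul_pow, h1, h2] at h3
      simp only [Ka, Kc]
      linarith
    _ = _ := by
      rw [lintegral_add_left (by fun_prop), lintegral_const_mul _ (by fun_prop),
        lintegral_const_mul _ (by fun_prop), lintegral_truncPow_sub_sum _ _ hb,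
        lintegral_truncPow_sub_sum _ _ hb', ← ENNReal.ofReal_mul hKa, ← ENNReal.ofReal_mul hKc,
        ← ENNReal.ofReal_add (mul_nonneg hKa (mul_nonneg (truncPow_nonneg _ _) hbp))
          (mul_nonneg hKc (mul_nonneg (truncPow_nonneg _ _) hbp'))]
      congr 1
      simp only [Ka, Kc, truncPow, zero_le_one, if_true, one_pow, ← one_div_pow,
        Finset.prod_pow]
      ring

theorem AffineIndependent.mem_extremePoints_convexHull {ι E : Type*} [Finite ι]
    [NormedAddCommGroup E] [NormedSpace ℝ E] {f : ι → E} (hf : AffineIndependent ℝ f) (i : ι) :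
    f i ∈ (convexHull ℝ (range f)).extremePoints ℝ := by
  by_contra hi
  have hfin : ((convexHull ℝ (range f)).extremePoints ℝ).Finite :=
    (finite_range f).subset extremePoints_convexHull_subset
  have hKM := closure_convexHull_extremePoints ((finite_range f).isCompact_convexHull ℝ)
    (convex_convexHull ℝ (range f))
  rw [(hfin.isClosed_convexHull ℝ).closure_eq] at hKM
  have hmem : f i ∈ convexHull ℝ ((convexHull ℝ (range f)).extremePoints ℝ) := by
    rw [hKM]
    exact subset_convexHull ℝ _ (mem_range_self i)
  refine hf.notMem_affineSpan_sdiff i univ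
    (convexHull_subset_affineSpan _ (convexHull_mono ?_ hmem))
  intro x hx
  obtain ⟨j, rfl⟩ := extremePoints_convexHull_subset hx
  exact ⟨j, ⟨mem_univ _, fun h => hi (h ▸ hx)⟩, rfl⟩

theorem AffineIndependent.extremePoints_convexHull {ι E : Type*} [Finite ι]
    [NormedAddCommGroup E] [NormedSpace ℝ E] {f : ι → E} (hf : AffineIndependent ℝ f) :
    (convexHull ℝ (range f)).extremePoints ℝ = range f :=
  extremePoints_convexHull_subset.antisymm
    (range_subset_iff.2 hf.mem_extremePoints_convexHull)

theorem IsSimplexOfDim.card_vertices {d k : ℕ} {S : Set (Fin d → ℝ)} (hS : IsSimplexOfDim k S)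
    {V : Finset (Fin d → ℝ)} (hV : (V : Set (Fin d → ℝ)) = S.extremePoints ℝ) :
    V.card = k + 1 := by
  obtain ⟨f, hf, rfl⟩ := hS
  rw [hf.extremePoints_convexHull] at hV
  rw [← Set.ncard_coe_finset, hV, ncard_range_of_injective hf.injective, Nat.card_fin]

theorem IsSimplexOfDim.eq_convexHull {d k : ℕ} {S : Set (Fin d → ℝ)} (hS : IsSimplexOfDim k S)
    {V : Finset (Fin d → ℝ)} (hV : (V : Set (Fin d → ℝ)) = S.extremePoints ℝ) :
    S = convexHull ℝ (V : Set (Fin d → ℝ)) := by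
  obtain ⟨f, hf, rfl⟩ := hS
  rw [hV, hf.extremePoints_convexHull]

theorem IsLatticePolytope.isLatticePt_of_mem_extremePoints {d : ℕ} {P : Set (Fin d → ℝ)}
    (hP : IsLatticePolytope P) {v : Fin d → ℝ} (hv : v ∈ P.extremePoints ℝ) : IsLatticePt v := by
  obtain ⟨V, hV, rfl⟩ := hP
  exact hV v (extremePoints_convexHull_subset hv)

/-- An integer matrix with nonzero determinant does not shrink volumes. -/
theorem volume_preimage_mulVec_le {ι : Type*} [Fintype ι] [DecidableEq ι] {M : Matrix ι ι ℝ}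
    (hM : ∀ i j, ∃ z : ℤ, M i j = z) (hdet : M.det ≠ 0) {T : Set (ι → ℝ)} (hT : MeasurableSet T) :
    volume (M.mulVec ⁻¹' T) ≤ volume T := by
  choose N hN using hM
  have hMN : M = (Matrix.of N).map fun x => (x : ℝ) := by
    ext i j
    simp [hN]
  have hone : 1 ≤ |M.det| := by
    rw [hMN, ← Int.cast_det] at hdet ⊢
    exact_mod_cast Int.one_le_abs (Int.cast_ne_zero.1 hdet)
  have h : Measure.map M.mulVec volume T = ENNReal.ofReal |M.det⁻¹| * volume T :=
    congrArg (· T) (Real.map_matrix_volume_pi_eq_smul_volume_pi hdet)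
  rw [← Measure.map_apply (Continuous.measurable (by fun_prop)) hT, h]
  refine mul_le_of_le_one_left zero_le ?_
  rw [ENNReal.ofReal_le_one, abs_inv]
  exact inv_le_one_of_one_le₀ hone

/-- Regrouping coordinates into three blocks preserves Lebesgue measure. -/
theorem measurePreserving_regroup {ι α A B : Type*} [Fintype ι] [Fintype α] [Fintype A]
    [Fintype B] (e : α ⊕ A ⊕ B ≃ ι) :
    MeasurePreserving (fun x : ι → ℝ => ((fun i => x (e (.inl i)), fun i => x (e (.inr (.inl i))),
      fun i => x (e (.inr (.inr i)))) : (α → ℝ) × (A → ℝ) × (B → ℝ))) := by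
  have h := ((MeasurePreserving.id volume).prod
      (volume_measurePreserving_sumPiEquivProdPi fun _ : A ⊕ B => ℝ)).comp
    ((volume_measurePreserving_sumPiEquivProdPi fun _ : α ⊕ A ⊕ B => ℝ).comp
      (volume_measurePreserving_piCongrLeft (fun _ => ℝ) e.symm))
  refine (congrArg (MeasurePreserving · volume volume) (funext fun x => ?_)).mpr h
  have hx : ∀ i, MeasurableEquiv.piCongrLeft (fun _ => ℝ) e.symm x i = x (e i) := fun i => by
    rw [← e.symm_apply_apply i, MeasurableEquiv.coe_piCongrLeft,
      Equiv.piCongrLeft_apply_apply, e.symm_apply_apply]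
  exact Prod.ext (funext fun i => (hx _).symm)
    (Prod.ext (funext fun i => (hx _).symm) (funext fun i => (hx _).symm))

theorem sum_eq_add_add_sum_sdiff {E M : Type*} [DecidableEq E] [AddCommMonoid M]
    {V W : Finset E} (hW : W ⊆ V) {v : E} (hv : v ∈ V \ W) (f : E → M) :
    ∑ w ∈ V, f w = f v + (∑ w ∈ W, f w + ∑ w ∈ V \ insert v W, f w) := by
  rw [Finset.mem_sdiff] at hv
  rw [← Finset.sum_sdiff (Finset.insert_subset hv.1 hW), Finset.sum_insert hv.2]
  abel

theorem dotProduct_barycentre {d : ℕ} {V W : Finset (Fin d → ℝ)} (hW : W ⊆ V)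
    {v : Fin d → ℝ} (hv : v ∈ V \ W) {β : (Fin d → ℝ) → ℝ} (hβ : ∑ w ∈ V, β w • w = 0)
    (y : Fin d → ℝ) :
    β v * (v ⬝ᵥ y) + (∑ w ∈ W, β w * (w ⬝ᵥ y) + ∑ w ∈ V \ insert v W, β w * (w ⬝ᵥ y)) = 0 := by
  rw [← sum_eq_add_add_sum_sdiff hW hv (fun w => β w * (w ⬝ᵥ y))]
  simp_rw [← smul_eq_mul, ← smul_dotProduct, ← sum_dotProduct, hβ, zero_dotProduct]

theorem eq_zero_of_dotProduct_eq_zero {d : ℕ} {P : Set (Fin d → ℝ)} (h0 : 0 ∈ interior P)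
    {y : Fin d → ℝ} (hy : ∀ x ∈ P, x ⬝ᵥ y = 0) : y = 0 := by
  have hlim : Filter.Tendsto (fun t : ℝ => t • y) (nhdsWithin 0 (Ioi 0)) (nhds 0) := by
    have : Continuous fun t : ℝ => t • y := by fun_prop
    simpa using (this.tendsto 0).mono_left nhdsWithin_le_nhds
  obtain ⟨t, ht, hpos⟩ := ((hlim.eventually (mem_interior_iff_mem_nhds.1 h0)).and
    self_mem_nhdsWithin).exists
  have := hy _ ht
  rw [smul_dotProduct, smul_eq_mul, mul_eq_zero] at this
  exact dotProduct_self_eq_zero.1 (this.resolve_left (ne_of_gt hpos))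

/-- Let `P ⊂ ℝ^d` be a canonical Fano polytope with
`P = conv(S₁ ∪ S₂)`, where `Sᵢ` is a `dᵢ`-simplex with vertex set `Vᵢ ⊆ vert(P)` and
`0` in its relative interior. Set `𝒱 = V₁ ∩ V₂`, `q = |𝒱|`, assume `d₁ + d₂ = d + q`
and `𝒱 ≠ Vᵢ`, and let `(β_{i,v})` be the barycentric coordinates of the origin in
`Sᵢ`. Then for any `v₁ ∈ V₁ ∖ 𝒱` and `v₂ ∈ V₂ ∖ 𝒱`:
`vol(P*) ≤ (1/2) ∑_{i=1,2} [(2(dᵢ - q))! / ((2dᵢ - q)!((dᵢ - q)!)²)] ·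
  ∏_{v ∈ 𝒱} (1/β_{i,v}) · ∏_{v ∈ Vᵢ ∖ (𝒱 ∪ {vᵢ})} (1/β_{i,v}²)`. -/
theorem dual_volume_integration_bound (d d1 d2 : ℕ) (P S1 S2 : Set (Fin d → ℝ))
    (hP : IsCanonicalFano P) (hPconv : P = convexHull ℝ (S1 ∪ S2))
    (hS1 : IsSimplexOfDim d1 S1) (hS2 : IsSimplexOfDim d2 S2)
    (h01 : (0 : Fin d → ℝ) ∈ intrinsicInterior ℝ S1)
    (h02 : (0 : Fin d → ℝ) ∈ intrinsicInterior ℝ S2)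
    (hsub1 : Set.extremePoints ℝ S1 ⊆ Set.extremePoints ℝ P)
    (hsub2 : Set.extremePoints ℝ S2 ⊆ Set.extremePoints ℝ P)
    (V1 V2 : Finset (Fin d → ℝ))
    (hV1 : (V1 : Set (Fin d → ℝ)) = Set.extremePoints ℝ S1)
    (hV2 : (V2 : Set (Fin d → ℝ)) = Set.extremePoints ℝ S2)
    (q : ℕ) (hq : q = (V1 ∩ V2).card) (hd12 : d1 + d2 = d + q)
    (hproper1 : V1 ∩ V2 ≠ V1) (hproper2 : V1 ∩ V2 ≠ V2)
    (β1 β2 : (Fin d → ℝ) → ℝ)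
    (hβ1pos : ∀ v ∈ V1, 0 < β1 v) (hβ1sum : ∑ v ∈ V1, β1 v = 1)
    (hβ1bar : ∑ v ∈ V1, β1 v • v = 0)
    (hβ2pos : ∀ v ∈ V2, 0 < β2 v) (hβ2sum : ∑ v ∈ V2, β2 v = 1)
    (hβ2bar : ∑ v ∈ V2, β2 v • v = 0)
    (v1 v2 : Fin d → ℝ) (hv1 : v1 ∈ V1 \ (V1 ∩ V2)) (hv2 : v2 ∈ V2 \ (V1 ∩ V2)) :
    volume (polarDual P) ≤ ENNReal.ofReal ((1 / 2) *
      (((2 * (d1 - q)).factorial : ℝ) /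
          (((2 * d1 - q).factorial : ℝ) * (((d1 - q).factorial : ℝ)) ^ 2) *
          (∏ v ∈ V1 ∩ V2, 1 / β1 v) *
          (∏ v ∈ V1 \ insert v1 (V1 ∩ V2), 1 / (β1 v) ^ 2) +
        ((2 * (d2 - q)).factorial : ℝ) /
          (((2 * d2 - q).factorial : ℝ) * (((d2 - q).factorial : ℝ)) ^ 2) *
          (∏ v ∈ V1 ∩ V2, 1 / β2 v) *
          (∏ v ∈ V2 \ insert v2 (V1 ∩ V2), 1 / (β2 v) ^ 2))) := by
  set W := V1 ∩ V2 with hWdef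
  have hW1 : W ⊆ V1 := Finset.inter_subset_left
  have hW2 : W ⊆ V2 := Finset.inter_subset_right
  set A := V1 \ insert v1 W with hA
  set B := V2 \ insert v2 W with hB
  have hcard1 := hS1.card_vertices hV1
  have hcard2 := hS2.card_vertices hV2
  have hm1 := Finset.mem_sdiff.1 hv1
  have hm2 := Finset.mem_sdiff.1 hv2
  have hcardA : A.card + (q + 1) = d1 + 1 := by
    rw [hq, ← Finset.card_insert_of_notMem hm1.2, ← hcard1]
    exact Finset.card_sdiff_add_card_eq_card (Finset.insert_subset hm1.1 hW1)
  have hcardB : B.card + (q + 1) = d2 + 1 := by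
    rw [hq, ← Finset.card_insert_of_notMem hm2.2, ← hcard2]
    exact Finset.card_sdiff_add_card_eq_card (Finset.insert_subset hm2.1 hW2)
  have hAV : A ⊆ V1 := Finset.sdiff_subset
  have hBV : B ⊆ V2 := Finset.sdiff_subset
  have h0 : (0 : Fin d → ℝ) ∈ interior P :=
    (show (0 : Fin d → ℝ) ∈ {x ∈ interior P | IsLatticePt x} by rw [hP.2]; rfl).1
  have hlat1 : ∀ v ∈ V1, IsLatticePt v := fun v hv =>
    hP.1.isLatticePt_of_mem_extremePoints (hsub1 (hV1 ▸ hv))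
  have hlat2 : ∀ v ∈ V2, IsLatticePt v := fun v hv =>
    hP.1.isLatticePt_of_mem_extremePoints (hsub2 (hV2 ▸ hv))
  have hmem1 : ∀ v ∈ V1, v ∈ P := fun v hv => (hsub1 (hV1 ▸ hv)).1
  have hmem2 : ∀ v ∈ V2, v ∈ P := fun v hv => (hsub2 (hV2 ▸ hv)).1
  have hbar1 := dotProduct_barycentre hW1 hv1 hβ1bar
  have hbar2 := dotProduct_barycentre hW2 hv2 hβ2bar
  have hsum1 := sum_eq_add_add_sum_sdiff hW1 hv1 β1
  have hsum2 := sum_eq_add_add_sum_sdiff hW2 hv2 β2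
  rw [hβ1sum] at hsum1
  rw [hβ2sum] at hsum2
  let e : W ⊕ A ⊕ B ≃ Fin d := Fintype.equivFinOfCardEq (by simp; omega)
  let w : W ⊕ A ⊕ B → Fin d → ℝ := Sum.elim (↑) (Sum.elim (↑) (↑))
  let M : Matrix (Fin d) (Fin d) ℝ := Matrix.of fun i => w (e.symm i)
  have hMe : ∀ s y, M.mulVec y (e s) = w s ⬝ᵥ y := fun s y => by
    simp [M, Matrix.mulVec]
  have hlat : ∀ s, IsLatticePt (w s) := by
    rintro (s | s | s)
    exacts [hlat1 _ (hW1 s.2), hlat1 _ (hAV s.2), hlat2 _ (hBV s.2)]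
  have hmem : ∀ s, w s ∈ P := by
    rintro (s | s | s)
    exacts [hmem1 _ (hW1 s.2), hmem1 _ (hAV s.2), hmem2 _ (hBV s.2)]
  have hdet : M.det ≠ 0 := by
    intro h
    obtain ⟨y, hy0, hy⟩ := Matrix.exists_mulVec_eq_zero_iff.2 h
    have hws : ∀ s, w s ⬝ᵥ y = 0 := fun s => by rw [← hMe, hy]; rfl
    have hWy : ∀ v ∈ W, v ⬝ᵥ y = 0 := fun v hv => hws (.inl ⟨v, hv⟩)
    have hAy : ∀ v ∈ A, v ⬝ᵥ y = 0 := fun v hv => hws (.inr (.inl ⟨v, hv⟩))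
    have hBy : ∀ v ∈ B, v ⬝ᵥ y = 0 := fun v hv => hws (.inr (.inr ⟨v, hv⟩))
    have hv1y : v1 ⬝ᵥ y = 0 := by
      have := hbar1 y
      rw [Finset.sum_eq_zero fun v hv => by rw [hWy v hv, mul_zero],
        Finset.sum_eq_zero fun v hv => by rw [hAy v hv, mul_zero]] at this
      simpa [(hβ1pos v1 hm1.1).ne'] using this
    have hv2y : v2 ⬝ᵥ y = 0 := by
      have := hbar2 y
      rw [Finset.sum_eq_zero fun v hv => by rw [hWy v hv, mul_zero],
        Finset.sum_eq_zero fun v hv => by rw [hBy v hv, mul_zero]] at this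
      simpa [(hβ2pos v2 hm2.1).ne'] using this
    have hconv : Convex ℝ {x : Fin d → ℝ | x ⬝ᵥ y = 0} := by
      intro a ha b hb s t _ _ _
      simp only [mem_ofPred_eq] at ha hb ⊢
      simp [add_dotProduct, smul_dotProduct, ha, hb]
    refine hy0 (eq_zero_of_dotProduct_eq_zero h0 fun x hx => ?_)
    rw [hPconv] at hx
    refine convexHull_min (union_subset ?_ ?_) hconv hx
    · rw [hS1.eq_convexHull hV1]
      refine convexHull_min (fun v hv => ?_) hconv
      by_cases h : v ∈ A
      · exact hAy v h
      · have : v = v1 ∨ v ∈ W := by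
          simpa [hA, Finset.mem_coe.1 hv, ← or_iff_not_imp_left] using h
        rcases this with rfl | h
        exacts [hv1y, hWy v h]
    · rw [hS2.eq_convexHull hV2]
      refine convexHull_min (fun v hv => ?_) hconv
      by_cases h : v ∈ B
      · exact hBy v h
      · have : v = v2 ∨ v ∈ W := by
          simpa [hB, Finset.mem_coe.1 hv, ← or_iff_not_imp_left] using h
        rcases this with rfl | h
        exacts [hv2y, hWy v h]
  let Q : Set ((W → ℝ) × (A → ℝ) × (B → ℝ)) :=
    {z | ∑ i : W, β1 i * z.1 i + ∑ i : A, β1 i * z.2.1 i ≤ 1 ∧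
      ∑ i : W, β2 i * z.1 i + ∑ i : B, β2 i * z.2.2 i ≤ 1}
  let O : Set ((W → ℝ) × (A → ℝ) × (B → ℝ)) := Ici 0 ×ˢ Ici 0 ×ˢ Ici 0
  have hQ : MeasurableSet Q := by
    simp only [Q]
    rw [ofPred_and]
    exact (measurableSet_le (by fun_prop) (by fun_prop)).inter
      (measurableSet_le (by fun_prop) (by fun_prop))
  have hO : MeasurableSet O := measurableSet_Ici.prod (measurableSet_Ici.prod measurableSet_Ici)
  have hmp := measurePreserving_regroup e
  set φ := fun x : Fin d → ℝ => ((fun i => x (e (.inl i)), fun i => x (e (.inr (.inl i))),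
      fun i => x (e (.inr (.inr i)))) : (W → ℝ) × (A → ℝ) × (B → ℝ)) with hφ
  have hsub : polarDual P ⊆ M.mulVec ⁻¹' ((· + 1) ⁻¹' (φ ⁻¹' (Q ∩ O))) := by
    intro y hy
    have hge : ∀ x ∈ P, 0 ≤ x ⬝ᵥ y + 1 := fun x hx => by
      have := hy x hx
      change -1 ≤ y ⬝ᵥ x at this
      rw [dotProduct_comm] at this
      linarith
    have hval : ∀ s, (M.mulVec y + 1) (e s) = w s ⬝ᵥ y + 1 := fun s => by
      rw [Pi.add_apply, hMe, Pi.one_apply]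
    simp only [mem_preimage, hφ, hval]
    refine ⟨⟨?_, ?_⟩, fun s => ?_, fun s => ?_, fun s => ?_⟩
    · change ∑ i : W, β1 i * ((i : Fin d → ℝ) ⬝ᵥ y + 1) +
        ∑ i : A, β1 i * ((i : Fin d → ℝ) ⬝ᵥ y + 1) ≤ 1
      rw [Finset.sum_coe_sort W fun v => β1 v * (v ⬝ᵥ y + 1),
        Finset.sum_coe_sort A fun v => β1 v * (v ⬝ᵥ y + 1)]
      simp_rw [mul_add, mul_one, Finset.sum_add_distrib]
      have := mul_nonneg (hβ1pos v1 hm1.1).le (hge v1 (hmem1 _ hm1.1))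
      linarith [hbar1 y]
    · change ∑ i : W, β2 i * ((i : Fin d → ℝ) ⬝ᵥ y + 1) +
        ∑ i : B, β2 i * ((i : Fin d → ℝ) ⬝ᵥ y + 1) ≤ 1
      rw [Finset.sum_coe_sort W fun v => β2 v * (v ⬝ᵥ y + 1),
        Finset.sum_coe_sort B fun v => β2 v * (v ⬝ᵥ y + 1)]
      simp_rw [mul_add, mul_one, Finset.sum_add_distrib]
      have := mul_nonneg (hβ2pos v2 hm2.1).le (hge v2 (hmem2 _ hm2.1))
      linarith [hbar2 y]
    · exact hge _ (hmem (.inl s))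
    · exact hge _ (hmem (.inr (.inl s)))
    · exact hge _ (hmem (.inr (.inr s)))
  have hmeas : MeasurableSet ((· + 1) ⁻¹' (φ ⁻¹' (Q ∩ O))) :=
    (measurable_add_const _) (hmp.measurable (hQ.inter hO))
  have key := orthantMeasure_prod_le (b := fun i : W => β1 i) (b' := fun i : W => β2 i)
    (a := fun i : A => β1 i) (c := fun i : B => β2 i) (fun i => hβ1pos _ (hW1 i.2))
    (fun i => hβ2pos _ (hW2 i.2)) (fun i => hβ1pos _ (hAV i.2)) (fun i => hβ2pos _ (hBV i.2))
  have hcA : d1 - q = A.card := by omega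
  have hcB : d2 - q = B.card := by omega
  have hcA' : 2 * d1 - q = 2 * A.card + W.card := by omega
  have hcB' : 2 * d2 - q = 2 * B.card + W.card := by omega
  simp only [Fintype.card_coe] at key
  rw [Finset.prod_coe_sort W fun v => 1 / β1 v, Finset.prod_coe_sort W fun v => 1 / β2 v,
    Finset.prod_coe_sort A fun v => 1 / β1 v ^ 2,
    Finset.prod_coe_sort B fun v => 1 / β2 v ^ 2] at key
  rw [hcA, hcB, hcA', hcB']
  refine ((measure_mono hsub).trans (volume_preimage_mulVec_le ?_ hdet hmeas)).trans ?_
  · intro i j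
    exact hlat (e.symm i) j
  · rw [measure_preimage_add_right, hmp.measure_preimage (hQ.inter hO).nullMeasurableSet,
      ← Measure.restrict_apply hQ]
    refine le_trans (le_of_eq ?_) key
    rw [orthantMeasure_eq, orthantMeasure_eq, orthantMeasure_eq, Measure.prod_restrict,
      Measure.prod_restrict]
    rfl
end
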